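/- arXiv:1406.6712 — 2 statements merged into one kernel-verified Lean document; each statement's English description precedes it below -/
import Mathlib

section
/- Let N, m be positive integers with m < N^2, let C > 0, and let 𝒜 : M_N → ℝ^m be a linear map such that every X in the kernel of 𝒜 satisfies ‖X‖_{S_2} ≤ C (m/N)^{1/2} ‖X‖_{S_1} (the Matrix Width Property). Then for every positive integer s with s < (1/4) C^{−2} N/m, for every X ∈ M_N and every minimizer X* of ‖Z‖_{S_1} over all Z ∈ M_N with 𝒜Z = 𝒜X, one has ‖X − X*‖_{S_2} ≤ C (m/N)^{1/2} · 2(1 − 2C(s m/N)^{1/2})^{−1} · ρ_s(X)_{S_1}. -/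
noncomputable def singVals {N : ℕ} (X : Matrix (Fin N) (Fin N) ℝ) : Fin N → ℝ :=
  fun i => Real.sqrt ((Matrix.isHermitian_conjTranspose_mul_self X).eigenvalues i)

/-- The Schatten `p`-quasi-norm of a real `N × N` matrix. -/
noncomputable def schattenNorm {N : ℕ} (p : ℝ) (X : Matrix (Fin N) (Fin N) ℝ) : ℝ :=
  (∑ i, singVals X i ^ p) ^ (1 / p)

/-- Best rank-`s` approximation error in the Schatten `p`-quasi-norm. -/
noncomputable def rhoS {N : ℕ} (p : ℝ) (s : ℕ) (X : Matrix (Fin N) (Fin N) ℝ) : ℝ :=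
  sInf ((fun Y => schattenNorm p (X - Y)) '' {Y | Y.rank ≤ s})

section Hermitian

open Matrix

variable {n : Type*} [Fintype n] [DecidableEq n]

/-- Real form of the spectral theorem, with the diagonalizing orthogonal matrix made explicit. -/
theorem Matrix.IsHermitian.exists_orthogonal_diagonalization {A : Matrix n n ℝ}
    (hA : A.IsHermitian) :
    ∃ U : Matrix n n ℝ, Uᵀ * U = 1 ∧ U * Uᵀ = 1 ∧ A = U * diagonal hA.eigenvalues * Uᵀ := by
  refine ⟨hA.eigenvectorUnitary, ?_, ?_, ?_⟩
  · simpa [star_eq_conjTranspose] using Unitary.coe_star_mul_self hA.eigenvectorUnitary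
  · simpa [star_eq_conjTranspose] using Unitary.coe_mul_star_self hA.eigenvectorUnitary
  · have h := hA.spectral_theorem
    rw [Unitary.conjStarAlgAut_apply] at h
    simpa [star_eq_conjTranspose, Function.comp_def] using h

theorem Matrix.IsHermitian.exists_orthogonal_diagonalization_mul_self {A : Matrix n n ℝ}
    (hA : A.IsHermitian) :
    ∃ U : Matrix n n ℝ, Uᵀ * U = 1 ∧
      A * A = U * diagonal (fun i => hA.eigenvalues i ^ 2) * Uᵀ := by
  obtain ⟨U, hU, -, hAU⟩ := hA.exists_orthogonal_diagonalization
  refine ⟨U, hU, ?_⟩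
  conv_lhs => rw [hAU]
  rw [show ∀ D : Matrix n n ℝ, U * D * Uᵀ * (U * D * Uᵀ) = U * (D * (Uᵀ * U) * D) * Uᵀ by
    intro D; simp only [mul_assoc], hU, mul_one, diagonal_mul_diagonal]
  simp only [sq]

theorem Matrix.dotProduct_conj_diagonal_mulVec (U : Matrix n n ℝ) (d x : n → ℝ) :
    x ⬝ᵥ (U * diagonal d * Uᵀ) *ᵥ x = ∑ j, d j * (Uᵀ *ᵥ x) j ^ 2 := by
  rw [← mulVec_mulVec, ← mulVec_mulVec, dotProduct_mulVec, ← mulVec_transpose]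
  simp only [dotProduct, mulVec_diagonal]
  exact Finset.sum_congr rfl fun j _ => by ring

theorem Matrix.sum_sq_orthogonal_mulVec {U : Matrix n n ℝ} (hU : U * Uᵀ = 1) (x : n → ℝ) :
    ∑ j, (Uᵀ *ᵥ x) j ^ 2 = x ⬝ᵥ x := by
  have h := dotProduct_conj_diagonal_mulVec U (fun _ => 1) x
  simpa [hU] using h.symm

/-- Weyl's monotonicity principle for the ordered eigenvalues of Hermitian matrices. -/
theorem Matrix.IsHermitian.eigenvalues_le_of_posSemidef_sub {A B : Matrix n n ℝ}
    (hA : A.IsHermitian) (hB : B.IsHermitian) (h : (B - A).PosSemidef) (i : n) :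
    hA.eigenvalues i ≤ hB.eigenvalues i := by
  obtain ⟨U, -, hU, hAU⟩ := hA.exists_orthogonal_diagonalization
  obtain ⟨V, -, hV, hBV⟩ := hB.exists_orthogonal_diagonalization
  let e : n ≃ Fin (Fintype.card n) := (Fintype.equivOfCardEq (Fintype.card_fin _)).symm
  have hAe : ∀ j k, e j ≤ e k → hA.eigenvalues k ≤ hA.eigenvalues j := fun j k hjk =>
    hA.eigenvalues₀_antitone hjk
  have hBe : ∀ j k, e j ≤ e k → hB.eigenvalues k ≤ hB.eigenvalues j := fun j k hjk =>
    hB.eigenvalues₀_antitone hjk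
  let f : (n → ℝ) →ₗ[ℝ] ({j // e i < e j} ⊕ {j // e j < e i} → ℝ) :=
    LinearMap.pi (Sum.elim (fun j => LinearMap.proj j.1 ∘ₗ Uᵀ.mulVecLin)
      (fun j => LinearMap.proj j.1 ∘ₗ Vᵀ.mulVecLin))
  have hcard : Fintype.card ({j // e i < e j} ⊕ {j // e j < e i}) < Fintype.card n := by
    rw [Fintype.card_sum, Fintype.card_subtype, Fintype.card_subtype,
      ← Finset.card_union_of_disjoint
        (Finset.disjoint_filter.2 fun j _ h₁ h₂ => lt_asymm h₁ h₂)]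
    refine Finset.card_lt_univ_of_notMem (x := i) ?_
    simp
  have hker : LinearMap.ker f ≠ ⊥ := LinearMap.ker_ne_bot_of_finrank_lt (by simpa using hcard)
  obtain ⟨x, hx, hx0⟩ := (Submodule.ne_bot_iff _).1 hker
  have hfx : f x = 0 := hx
  have hUx : ∀ j, e i < e j → (Uᵀ *ᵥ x) j = 0 := fun j hj => congrFun hfx (Sum.inl ⟨j, hj⟩)
  have hVx : ∀ j, e j < e i → (Vᵀ *ᵥ x) j = 0 := fun j hj => congrFun hfx (Sum.inr ⟨j, hj⟩)
  have hlow : hA.eigenvalues i * (x ⬝ᵥ x) ≤ x ⬝ᵥ A *ᵥ x := by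
    conv_rhs => rw [hAU]
    rw [dotProduct_conj_diagonal_mulVec, ← sum_sq_orthogonal_mulVec hU, Finset.mul_sum]
    refine Finset.sum_le_sum fun j _ => ?_
    rcases le_or_gt (e j) (e i) with hj | hj
    · exact mul_le_mul_of_nonneg_right (hAe _ _ hj) (sq_nonneg _)
    · simp [hUx j hj]
  have hupp : x ⬝ᵥ B *ᵥ x ≤ hB.eigenvalues i * (x ⬝ᵥ x) := by
    conv_lhs => rw [hBV]
    rw [dotProduct_conj_diagonal_mulVec, ← sum_sq_orthogonal_mulVec hV, Finset.mul_sum]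
    refine Finset.sum_le_sum fun j _ => ?_
    rcases le_or_gt (e i) (e j) with hj | hj
    · exact mul_le_mul_of_nonneg_right (hBe _ _ hj) (sq_nonneg _)
    · simp [hVx j hj]
  have hmid : x ⬝ᵥ A *ᵥ x ≤ x ⬝ᵥ B *ᵥ x := by
    have := h.dotProduct_mulVec_nonneg x
    rw [sub_mulVec, dotProduct_sub] at this
    simpa using this
  have hpos : 0 < x ⬝ᵥ x := by
    simpa using dotProduct_star_self_pos_iff.2 hx0
  exact le_of_mul_le_mul_right (hlow.trans (hmid.trans hupp)) hpos

/-- The positive part of a Hermitian matrix. -/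
theorem Matrix.IsHermitian.exists_posPart {A : Matrix n n ℝ} (hA : A.IsHermitian) :
    ∃ P : Matrix n n ℝ, P.PosSemidef ∧ (P - A).PosSemidef ∧
      2 * P.trace - A.trace = ∑ i, |hA.eigenvalues i| := by
  obtain ⟨U, hU, -, hAU⟩ := hA.exists_orthogonal_diagonalization
  have htr : ∀ d : n → ℝ, (U * diagonal d * Uᵀ).trace = ∑ i, d i := fun d => by
    rw [trace_mul_comm, ← mul_assoc, hU, one_mul, trace_diagonal]
  have hpsd : ∀ d : n → ℝ, 0 ≤ d → (U * diagonal d * Uᵀ).PosSemidef := fun d hd => by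
    simpa using (PosSemidef.diagonal hd).mul_mul_conjTranspose_same U
  have hsub : U * diagonal (fun i => max (hA.eigenvalues i) 0) * Uᵀ - A =
      U * diagonal (fun i => max (hA.eigenvalues i) 0 - hA.eigenvalues i) * Uᵀ := by
    rw [← diagonal_sub, mul_sub, sub_mul, ← hAU]
  refine ⟨U * diagonal (fun i => max (hA.eigenvalues i) 0) * Uᵀ, hpsd _ fun i => le_max_right _ _,
    ?_, ?_⟩
  · rw [hsub]
    exact hpsd _ fun i => sub_nonneg.2 (le_max_left _ _)
  · rw [htr, hA.trace_eq_sum_eigenvalues, Finset.mul_sum, ← Finset.sum_sub_distrib]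
    refine Finset.sum_congr rfl fun i _ => ?_
    rcases le_total (hA.eigenvalues i) 0 with hi | hi
    · simp [max_eq_right hi, abs_of_nonpos hi]
    · simp [max_eq_left hi, abs_of_nonneg hi]
      ring

/-- Mirsky's inequality in the trace norm: the ordered eigenvalues of Hermitian matrices are
`1`-Lipschitz. -/
theorem Matrix.IsHermitian.sum_abs_eigenvalues_sub_le {A B : Matrix n n ℝ}
    (hA : A.IsHermitian) (hB : B.IsHermitian) (hAB : (A - B).IsHermitian) :
    ∑ i, |hA.eigenvalues i - hB.eigenvalues i| ≤ ∑ i, |hAB.eigenvalues i| := by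
  obtain ⟨P, hP, hPD, htr⟩ := hAB.exists_posPart
  have hC : (B + P).IsHermitian := hB.add hP.isHermitian
  have h₁ := hA.eigenvalues_le_of_posSemidef_sub hC
    (by rwa [show B + P - A = P - (A - B) by abel])
  have h₂ := hB.eigenvalues_le_of_posSemidef_sub hC (by rwa [add_sub_cancel_left])
  calc ∑ i, |hA.eigenvalues i - hB.eigenvalues i|
      ≤ ∑ i, (2 * hC.eigenvalues i - hA.eigenvalues i - hB.eigenvalues i) :=
        Finset.sum_le_sum fun i _ => abs_le.2 ⟨by linarith [h₁ i, h₂ i], by linarith [h₁ i, h₂ i]⟩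
    _ = 2 * (B + P).trace - A.trace - B.trace := by
        simp [hA.trace_eq_sum_eigenvalues, hB.trace_eq_sum_eigenvalues,
          hC.trace_eq_sum_eigenvalues, Finset.sum_sub_distrib, Finset.mul_sum, -trace_add]
    _ = ∑ i, |hAB.eigenvalues i| := by
        rw [← htr, trace_add, trace_sub]
        ring

theorem Matrix.IsHermitian.sum_sq_eigenvalues {A : Matrix n n ℝ} (hA : A.IsHermitian) :
    ∑ i, hA.eigenvalues i ^ 2 = (A * A).trace := by
  obtain ⟨U, hU, hsq⟩ := hA.exists_orthogonal_diagonalization_mul_self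
  rw [hsq, trace_mul_comm, ← mul_assoc, hU, one_mul, trace_diagonal]

theorem Matrix.IsHermitian.sum_abs_eigenvalues_le_add {A B : Matrix n n ℝ}
    (hA : A.IsHermitian) (hB : B.IsHermitian) (hAB : (A - B).IsHermitian) :
    ∑ i, |hA.eigenvalues i| ≤ ∑ i, |hAB.eigenvalues i| + ∑ i, |hB.eigenvalues i| := by
  refine le_trans ?_ (add_le_add_left (hA.sum_abs_eigenvalues_sub_le hB hAB) _)
  rw [← Finset.sum_add_distrib]
  exact Finset.sum_le_sum fun i _ => by
    linarith [abs_sub_abs_le_abs_sub (hA.eigenvalues i) (hB.eigenvalues i)]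

/-- Perturbing by a Hermitian matrix of rank `r` is almost additive for the trace norm. -/
theorem Matrix.IsHermitian.sum_abs_eigenvalues_add_le {A B : Matrix n n ℝ}
    (hA : A.IsHermitian) (hB : B.IsHermitian) (hAB : (A - B).IsHermitian) :
    ∑ i, |hA.eigenvalues i| + ∑ i, |hB.eigenvalues i| ≤
      ∑ i, |hAB.eigenvalues i| + 2 * √(B.rank * (A * A).trace) := by
  set S : Finset n := {i | hB.eigenvalues i ≠ 0} with hS
  have hcard : (S.card : ℝ) = B.rank := by
    rw [hB.rank_eq_card_non_zero_eigs, Fintype.card_subtype]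
  have hCS : ∑ i ∈ S, |hA.eigenvalues i| ≤ √(B.rank * (A * A).trace) := by
    refine Real.le_sqrt_of_sq_le ?_
    rw [← hcard, ← hA.sum_sq_eigenvalues]
    refine sq_sum_le_card_mul_sum_sq.trans ?_
    simp only [sq_abs]
    exact mul_le_mul_of_nonneg_left
      (Finset.sum_le_sum_of_subset_of_nonneg (Finset.subset_univ _) fun _ _ _ => sq_nonneg _)
      (Nat.cast_nonneg _)
  have hpt : ∑ i, |hA.eigenvalues i| + ∑ i, |hB.eigenvalues i| ≤
      ∑ i, |hA.eigenvalues i - hB.eigenvalues i| + 2 * ∑ i ∈ S, |hA.eigenvalues i| := by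
    rw [Finset.sum_filter, Finset.mul_sum, ← Finset.sum_add_distrib, ← Finset.sum_add_distrib]
    refine Finset.sum_le_sum fun i _ => ?_
    by_cases hi : hB.eigenvalues i = 0
    · simp [hi]
    · have := abs_sub_abs_le_abs_sub (hB.eigenvalues i) (hA.eigenvalues i)
      rw [abs_sub_comm] at this
      simp only [ne_eq, hi, not_false_eq_true, if_true]
      linarith
  linarith [hA.sum_abs_eigenvalues_sub_le hB hAB]

/-- The absolute values of the eigenvalues of `A` are the square roots of those of `A * A`. -/
theorem Matrix.IsHermitian.sum_abs_eigenvalues_eq {A : Matrix n n ℝ} (hA : A.IsHermitian) :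
    ∑ i, |hA.eigenvalues i| = ((A * A).charpoly.roots.map Real.sqrt).sum := by
  obtain ⟨U, hU, hsq⟩ := hA.exists_orthogonal_diagonalization_mul_self
  rw [hsq, charpoly_mul_comm, ← mul_assoc, hU, one_mul, charpoly_diagonal, Polynomial.roots_prod]
  · simp [Real.sqrt_sq_eq_abs, -map_pow]
  · simp [Finset.prod_ne_zero_iff, Polynomial.X_sub_C_ne_zero, -map_pow]

end Hermitian

section Dilation

open Matrix

variable {N : ℕ}

/-- The self-adjoint dilation of a real square matrix. -/
def selfAdjointDilation (X : Matrix (Fin N) (Fin N) ℝ) :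
    Matrix (Fin N ⊕ Fin N) (Fin N ⊕ Fin N) ℝ :=
  fromBlocks 0 X Xᵀ 0

theorem selfAdjointDilation_isHermitian (X : Matrix (Fin N) (Fin N) ℝ) :
    (selfAdjointDilation X).IsHermitian := by
  simp [selfAdjointDilation, IsHermitian, fromBlocks_transpose]

theorem selfAdjointDilation_sub (X Y : Matrix (Fin N) (Fin N) ℝ) :
    selfAdjointDilation (X - Y) = selfAdjointDilation X - selfAdjointDilation Y := by
  simp [selfAdjointDilation, sub_eq_add_neg, fromBlocks_neg, fromBlocks_add]

theorem selfAdjointDilation_mul_self (X : Matrix (Fin N) (Fin N) ℝ) :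
    selfAdjointDilation X * selfAdjointDilation X = fromBlocks (X * Xᵀ) 0 0 (Xᵀ * X) := by
  simp [selfAdjointDilation, fromBlocks_multiply]

theorem Matrix.rank_add_le_rank_add_rank {m n : Type*} [Fintype m] [Fintype n]
    (A B : Matrix m n ℝ) : (A + B).rank ≤ A.rank + B.rank := by
  refine le_trans (Submodule.finrank_mono ?_)
    (Submodule.finrank_add_le_finrank_add_finrank A.mulVecLin.range B.mulVecLin.range)
  rintro _ ⟨x, rfl⟩
  rw [mulVecLin_add]
  exact Submodule.add_mem_sup ⟨x, rfl⟩ ⟨x, rfl⟩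

theorem rank_selfAdjointDilation_le (X : Matrix (Fin N) (Fin N) ℝ) :
    (selfAdjointDilation X).rank ≤ 2 * X.rank := by
  let E : Matrix (Fin N ⊕ Fin N) (Fin N) ℝ := fromRows 1 0
  let F : Matrix (Fin N ⊕ Fin N) (Fin N) ℝ := fromRows 0 1
  have h : selfAdjointDilation X = E * (X * Fᵀ) + F * (Xᵀ * Eᵀ) := by
    ext (i | i) (j | j) <;> simp [E, F, selfAdjointDilation, transpose_fromRows, mul_fromCols]
  have h₁ : (E * (X * Fᵀ)).rank ≤ X.rank := (rank_mul_le_right _ _).trans (rank_mul_le_left _ _)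
  have h₂ : (F * (Xᵀ * Eᵀ)).rank ≤ X.rank :=
    (rank_mul_le_right _ _).trans ((rank_mul_le_left _ _).trans (rank_transpose X).le)
  rw [h]
  linarith [Matrix.rank_add_le_rank_add_rank (E * (X * Fᵀ)) (F * (Xᵀ * Eᵀ))]

theorem schattenNorm_one (X : Matrix (Fin N) (Fin N) ℝ) :
    schattenNorm 1 X = ∑ i, singVals X i := by
  simp [schattenNorm]

theorem schattenNorm_two (X : Matrix (Fin N) (Fin N) ℝ) :
    schattenNorm 2 X = √(Xᵀ * X).trace := by
  have h : ∑ i, singVals X i ^ (2 : ℝ) = (Xᵀ * X).trace := by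
    rw [← conjTranspose_eq_transpose_of_trivial,
      (isHermitian_conjTranspose_mul_self X).trace_eq_sum_eigenvalues]
    refine Finset.sum_congr rfl fun i _ => ?_
    simp only [singVals, Real.rpow_two]
    exact Real.sq_sqrt ((posSemidef_conjTranspose_mul_self X).eigenvalues_nonneg i)
  rw [schattenNorm, h, Real.sqrt_eq_rpow]

theorem schattenNorm_neg (p : ℝ) (X : Matrix (Fin N) (Fin N) ℝ) :
    schattenNorm p (-X) = schattenNorm p X := by
  simp only [schattenNorm, singVals, conjTranspose_neg, neg_mul_neg]

theorem sum_abs_eigenvalues_selfAdjointDilation {X : Matrix (Fin N) (Fin N) ℝ}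
    (h : (selfAdjointDilation X).IsHermitian) :
    ∑ i, |h.eigenvalues i| = 2 * schattenNorm 1 X := by
  have hroots : ((Xᵀ * X).charpoly.roots.map Real.sqrt).sum = schattenNorm 1 X := by
    rw [schattenNorm_one, ← conjTranspose_eq_transpose_of_trivial,
      (isHermitian_conjTranspose_mul_self X).roots_charpoly_eq_eigenvalues, Multiset.map_map]
    rfl
  rw [h.sum_abs_eigenvalues_eq, selfAdjointDilation_mul_self, charpoly_fromBlocks_zero₁₂,
    charpoly_mul_comm X, Polynomial.roots_mul
      (mul_ne_zero (charpoly_monic _).ne_zero (charpoly_monic _).ne_zero),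
    Multiset.map_add, Multiset.sum_add, hroots]
  ring

theorem schattenNorm_one_le_add (X Y : Matrix (Fin N) (Fin N) ℝ) :
    schattenNorm 1 X ≤ schattenNorm 1 (X - Y) + schattenNorm 1 Y := by
  have hXY := selfAdjointDilation_isHermitian (X - Y)
  rw [selfAdjointDilation_sub] at hXY
  have h := (selfAdjointDilation_isHermitian X).sum_abs_eigenvalues_le_add
    (selfAdjointDilation_isHermitian Y) hXY
  simp only [← selfAdjointDilation_sub, sum_abs_eigenvalues_selfAdjointDilation] at h
  linarith

/-- If `Y` has rank at most `s`, then `‖V - Y‖_{S₁}` is at least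
`‖V‖_{S₁} + ‖Y‖_{S₁} - 2 √s ‖V‖_{S₂}`. -/
theorem schattenNorm_one_add_le_of_rank_le {V Y : Matrix (Fin N) (Fin N) ℝ} {s : ℕ}
    (hY : Y.rank ≤ s) :
    schattenNorm 1 V + schattenNorm 1 Y ≤
      schattenNorm 1 (V - Y) + 2 * (√s * schattenNorm 2 V) := by
  have hVY := selfAdjointDilation_isHermitian (V - Y)
  rw [selfAdjointDilation_sub] at hVY
  have h := (selfAdjointDilation_isHermitian V).sum_abs_eigenvalues_add_le
    (selfAdjointDilation_isHermitian Y) hVY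
  simp only [← selfAdjointDilation_sub, sum_abs_eigenvalues_selfAdjointDilation] at h
  have htr : (selfAdjointDilation V * selfAdjointDilation V).trace = 2 * (Vᵀ * V).trace := by
    rw [two_mul, selfAdjointDilation_mul_self]
    nth_rewrite 2 [trace_mul_comm]
    rw [add_comm]
    simp [trace, Fintype.sum_sum_type]
  have hnn : 0 ≤ (Vᵀ * V).trace := by
    simpa using (posSemidef_conjTranspose_mul_self V).trace_nonneg
  have hrank : ((selfAdjointDilation Y).rank : ℝ) ≤ 2 * s := by
    exact_mod_cast (rank_selfAdjointDilation_le Y).trans (Nat.mul_le_mul_left 2 hY)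
  have hsqrt : √((selfAdjointDilation Y).rank *
      (selfAdjointDilation V * selfAdjointDilation V).trace) ≤ 2 * (√s * schattenNorm 2 V) := by
    rw [htr, schattenNorm_two, ← Real.sqrt_mul (Nat.cast_nonneg s)]
    refine Real.sqrt_le_iff.2 ⟨by positivity, ?_⟩
    rw [mul_pow, Real.sq_sqrt (by positivity)]
    nlinarith [mul_le_mul_of_nonneg_right hrank hnn]
  linarith

end Dilation

/-- The Matrix Width Property implies the Matrix Strong Compressed Sensing Property. -/
theorem mwp_implies_mscsp (N m : ℕ) (hN : 0 < N) (hm : 0 < m) (hmN : m < N ^ 2)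
    (C : ℝ) (hC : 0 < C)
    (A : Matrix (Fin N) (Fin N) ℝ →ₗ[ℝ] EuclideanSpace ℝ (Fin m))
    (hMWP : ∀ X : Matrix (Fin N) (Fin N) ℝ, A X = 0 →
      schattenNorm 2 X ≤ C * ((m : ℝ) / N) ^ ((1 : ℝ) / 2) * schattenNorm 1 X)
    (s : ℕ) (hs : 0 < s) (hsmall : (s : ℝ) < (1 / 4) * C⁻¹ ^ 2 * ((N : ℝ) / m))
    (X Xstar : Matrix (Fin N) (Fin N) ℝ)
    (hfeas : A Xstar = A X)
    (hmin : ∀ Z : Matrix (Fin N) (Fin N) ℝ, A Z = A X →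
      schattenNorm 1 Xstar ≤ schattenNorm 1 Z) :
    schattenNorm 2 (X - Xstar) ≤
      C * ((m : ℝ) / N) ^ ((1 : ℝ) / 2) *
        (2 * (1 - 2 * C * ((s : ℝ) * m / N) ^ ((1 : ℝ) / 2))⁻¹) * rhoS 1 s X := by
  have hNr : (0 : ℝ) < N := Nat.cast_pos.2 hN
  have hmr : (0 : ℝ) < m := Nat.cast_pos.2 hm
  have hsr : (0 : ℝ) < s := Nat.cast_pos.2 hs
  rw [← Real.sqrt_eq_rpow, ← Real.sqrt_eq_rpow, mul_div_assoc, Real.sqrt_mul hsr.le]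
  rw [← Real.sqrt_eq_rpow] at hMWP
  set q := √((m : ℝ) / N) with hq
  have hq0 : 0 < q := Real.sqrt_pos.2 (by positivity)
  have hker : A (X - Xstar) = 0 := by rw [map_sub, hfeas, sub_self]
  have hV := hMWP _ hker
  have hgap : 0 < 1 - 2 * C * (√s * q) := by
    have hsq : (2 * C * (√s * q)) ^ 2 < 1 := by
      have : (2 * C * (√s * q)) ^ 2 = 4 * C ^ 2 * (s * (m / N)) := by
        rw [mul_pow, mul_pow, mul_pow, Real.sq_sqrt hsr.le, hq, Real.sq_sqrt (by positivity)]
        ring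
      rw [this]
      calc 4 * C ^ 2 * (s * (m / N))
          < 4 * C ^ 2 * ((1 / 4) * C⁻¹ ^ 2 * ((N : ℝ) / m) * (m / N)) := by gcongr
        _ = 1 := by field_simp
    have := (sq_lt_one_iff₀ (by positivity)).1 hsq
    linarith
  have hY : ∀ Y : Matrix (Fin N) (Fin N) ℝ, Y.rank ≤ s →
      (1 - 2 * C * (√s * q)) * schattenNorm 1 (X - Xstar) ≤ 2 * schattenNorm 1 (X - Y) := by
    intro Y hrank
    have h₁ := schattenNorm_one_add_le_of_rank_le (V := X - Xstar) hrank
    have h₂ := schattenNorm_one_le_add (X - Xstar - Y) (-Xstar)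
    rw [schattenNorm_neg, show X - Xstar - Y - -Xstar = X - Y by abel] at h₂
    have h₃ := schattenNorm_one_le_add X Y
    have h₄ := hmin X rfl
    have h₅ := mul_le_mul_of_nonneg_left hV (Real.sqrt_nonneg (s : ℝ))
    linarith
  have hrho : (1 - 2 * C * (√s * q)) * schattenNorm 1 (X - Xstar) / 2 ≤ rhoS 1 s X := by
    refine le_csInf ⟨_, 0, by simp, rfl⟩ ?_
    rintro _ ⟨Y, hrank, rfl⟩
    linarith [hY Y hrank]
  calc schattenNorm 2 (X - Xstar) ≤ C * q * schattenNorm 1 (X - Xstar) := hV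
    _ = C * q * (2 * (1 - 2 * C * (√s * q))⁻¹) *
        ((1 - 2 * C * (√s * q)) * schattenNorm 1 (X - Xstar) / 2) := by
        rw [mul_assoc (C * q), mul_assoc 2, ← mul_div_assoc, inv_mul_cancel_left₀ hgap.ne']
        ring
    _ ≤ C * q * (2 * (1 - 2 * C * (√s * q))⁻¹) * rhoS 1 s X := by gcongr
end

section
/- Let 0 < p ≤ 1, let N, m be positive integers, let 𝒜 : M_N → ℝ^m be a linear map, and for a positive integer k let α_k, β_k be the best constants with α_k ‖Z‖_{S_2} ≤ ‖𝒜Z‖_{ℓ2} ≤ β_k ‖Z‖_{S_2} for all Z ∈ M_N of rank at most k; assume α_{2t} > 0 and set γ_{2t} = β_{2t}^2/α_{2t}^2. Suppose s ≤ t are positive integers with γ_{2t} − 1 < 4(√2 − 1)(t/s)^{1/p − 1/2}. Let θ ≥ 0, y ∈ ℝ^m, and let X ∈ M_N satisfy ‖𝒜X − y‖_{ℓ2} ≤ β_{2s}·θ. Set λ := (1+√2)γ_{2t} and μ := (1/4)(1+√2)(γ_{2t}−1)(s/t)^{1/p−1/2}, so that μ < 1. Then every minimizer X* of ‖Z‖_{S_p}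 over all Z ∈ M_N with ‖𝒜Z − y‖_{ℓ2} ≤ β_{2s}·θ satisfies both ‖X − X*‖_{S_p} ≤ C₁ ρ_s(X)_{S_p} + D₁ s^{1/p−1/2} θ, where C₁ = 2^{2/p−1}(1+μ^p)^{1/p}/(1−μ^p)^{1/p} and D₁ = 2^{2/p−1}λ/(1−μ^p)^{1/p}, and ‖X − X*‖_{S_2} ≤ C₂ ρ_s(X)_{S_p}/t^{1/p−1/2} + D₂ θ, where C₂ = 2^{2/p−2}(λ+1−√2)/(1−μ^p)^{1/p} and D₂ = 2^{1/p−2}λ(λ+1−√2)/(1−μ^p)^{1/p} + 2λ. -/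
/-- Increments of the concave function `x ↦ x ^ p` decrease. -/
lemma rpow_add_add_rpow_le {p : ℝ} (hp0 : 0 ≤ p) (hp1 : p ≤ 1) {l x d : ℝ} (hl : 0 ≤ l)
    (hlx : l ≤ x) (hd : 0 ≤ d) : (x + d) ^ p + l ^ p ≤ (l + d) ^ p + x ^ p := by
  rcases hd.eq_or_lt with rfl | hd
  · simp [add_comm]
  have hw : 0 < x + d - l := by linarith
  have hconc := Real.concaveOn_rpow hp0 hp1
  have hl' : l ∈ Set.Ici (0 : ℝ) := hl
  have hx' : x + d ∈ Set.Ici (0 : ℝ) := by simp only [Set.mem_Ici]; linarith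
  have hsum : (x - l) / (x + d - l) + d / (x + d - l) = 1 := by field_simp; ring
  have ha : 0 ≤ (x - l) / (x + d - l) := div_nonneg (by linarith) hw.le
  have hb : 0 ≤ d / (x + d - l) := div_nonneg hd.le hw.le
  have h1 := hconc.2 hl' hx' ha hb hsum
  have h2 := hconc.2 hl' hx' hb ha (by rw [add_comm]; exact hsum)
  have e1 : (x - l) / (x + d - l) * l + d / (x + d - l) * (x + d) = l + d := by
    field_simp; ring
  have e2 : d / (x + d - l) * l + (x - l) / (x + d - l) * (x + d) = x := by
    field_simp; ring
  simp only [smul_eq_mul] at h1 h2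
  rw [e1] at h1
  rw [e2] at h2
  have h3 : (x + d) ^ p + l ^ p = ((x - l) / (x + d - l) + d / (x + d - l)) * ((x + d) ^ p + l ^ p) := by
    rw [hsum, one_mul]
  rw [h3]
  linarith

/-- If the intervals between `a i` and `b i` are stacked in decreasing order below `M`, then the
total variation of `x ↦ x ^ p` over them is at most its value at their total length. -/
lemma sum_abs_rpow_sub_le {p : ℝ} (hp0 : 0 < p) (hp1 : p ≤ 1) {n : ℕ} (a b : Fin n → ℝ) {M : ℝ}
    (hM : 0 ≤ M) (ha : ∀ i, 0 ≤ a i) (hb : ∀ i, 0 ≤ b i) (haM : ∀ i, a i ≤ M)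
    (hbM : ∀ i, b i ≤ M) (h : ∀ i j, i < j → max (a j) (b j) ≤ min (a i) (b i)) :
    ∑ i, |a i - b i| ≤ M ∧ ∑ i, |a i ^ p - b i ^ p| ≤ (∑ i, |a i - b i|) ^ p := by
  induction n generalizing M with
  | zero => simpa [Real.zero_rpow hp0.ne'] using hM
  | succ n ih =>
    obtain ⟨h1, h2⟩ := ih (fun i => a i.succ) (fun i => b i.succ) (M := min (a 0) (b 0))
      (le_min (ha 0) (hb 0)) (fun i => ha _) (fun i => hb _)
      (fun i => (le_max_left _ _).trans (h 0 i.succ (Fin.succ_pos i)))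
      (fun i => (le_max_right _ _).trans (h 0 i.succ (Fin.succ_pos i)))
      (fun i j hij => h _ _ (Fin.succ_lt_succ_iff.2 hij))
    have h0 : 0 ≤ ∑ i : Fin n, |a i.succ - b i.succ| := Finset.sum_nonneg fun _ _ => abs_nonneg _
    rw [Fin.sum_univ_succ, Fin.sum_univ_succ]
    set L := ∑ i : Fin n, |a i.succ - b i.succ|
    rcases le_total (a 0) (b 0) with hab | hab
    · rw [min_eq_left hab] at h1
      have h3 := rpow_add_add_rpow_le hp0.le hp1 h0 h1 (sub_nonneg.2 hab)
      have h4 := Real.rpow_le_rpow (ha 0) hab hp0.le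
      rw [abs_sub_comm (a 0), abs_sub_comm (a 0 ^ p), abs_of_nonneg (sub_nonneg.2 hab),
        abs_of_nonneg (sub_nonneg.2 h4), add_comm (b 0 - a 0)]
      rw [add_sub_cancel] at h3
      exact ⟨by linarith [hbM 0], by linarith⟩
    · rw [min_eq_right hab] at h1
      have h3 := rpow_add_add_rpow_le hp0.le hp1 h0 h1 (sub_nonneg.2 hab)
      have h4 := Real.rpow_le_rpow (hb 0) hab hp0.le
      rw [abs_of_nonneg (sub_nonneg.2 hab),
        abs_of_nonneg (sub_nonneg.2 h4), add_comm (a 0 - b 0)]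
      rw [add_sub_cancel] at h3
      exact ⟨by linarith [haM 0], by linarith⟩

/-- Weyl-type comparison for two quadratic forms diagonalised by the coordinate maps `b` and `c`,
one dominating the other on a subspace `U`. -/
lemma le_of_quadratic_le {ι κ V : Type*} [Fintype ι] [Fintype κ] [AddCommGroup V] [Module ℝ V]
    [FiniteDimensional ℝ V] (b : V →ₗ[ℝ] ι → ℝ) (c : V →ₗ[ℝ] κ → ℝ) (hb : Function.Injective b)
    (hbc : ∀ x, ∑ l, b x l ^ 2 = ∑ l, c x l ^ 2) (f : ι → ℝ) (g : κ → ℝ) (U : Submodule ℝ V)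
    (hU : ∀ x ∈ U, ∑ l, f l * b x l ^ 2 ≤ ∑ l, g l * c x l ^ 2)
    (P : Finset ι) (Q : Finset κ) {y z : ℝ} (hP : ∀ l, l ∉ P → y ≤ f l) (hQ : ∀ l, l ∉ Q → g l ≤ z)
    (hcard : P.card + Q.card < Module.finrank ℝ U) : y ≤ z := by
  classical
  let Φ : V →ₗ[ℝ] (P → ℝ) × (Q → ℝ) :=
    ((LinearMap.funLeft ℝ ℝ ((↑) : P → ι)).comp b).prod ((LinearMap.funLeft ℝ ℝ ((↑) : Q → κ)).comp c)
  have hker : LinearMap.ker (Φ.comp U.subtype) ≠ ⊥ := by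
    apply LinearMap.ker_ne_bot_of_finrank_lt
    simpa using hcard
  obtain ⟨x, hx, hx0⟩ := (Submodule.ne_bot_iff _).1 hker
  have hΦ : Φ x = 0 := hx
  have hbx : ∀ l ∈ P, b x l = 0 := fun l hl => congrFun (congrArg Prod.fst hΦ) ⟨l, hl⟩
  have hcx : ∀ l ∈ Q, c x l = 0 := fun l hl => congrFun (congrArg Prod.snd hΦ) ⟨l, hl⟩
  have hpos : 0 < ∑ l, b x l ^ 2 := by
    refine lt_of_le_of_ne (Finset.sum_nonneg fun _ _ => sq_nonneg _) fun h0 => hx0 ?_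
    have h1 := (Finset.sum_eq_zero_iff_of_nonneg fun l _ => sq_nonneg (b x l)).1 h0.symm
    apply Subtype.ext
    apply hb
    rw [Submodule.coe_zero, map_zero]
    funext l
    exact pow_eq_zero_iff two_ne_zero |>.1 (h1 l (Finset.mem_univ l))
  have h1 : y * ∑ l, b x l ^ 2 ≤ ∑ l, f l * b x l ^ 2 := by
    rw [Finset.mul_sum]
    refine Finset.sum_le_sum fun l _ => ?_
    by_cases hl : l ∈ P
    · simp [hbx l hl]
    · exact mul_le_mul_of_nonneg_right (hP l hl) (sq_nonneg _)
  have h2 : ∑ l, g l * c x l ^ 2 ≤ z * ∑ l, c x l ^ 2 := by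
    rw [Finset.mul_sum]
    refine Finset.sum_le_sum fun l _ => ?_
    by_cases hl : l ∈ Q
    · simp [hcx l hl]
    · exact mul_le_mul_of_nonneg_right (hQ l hl) (sq_nonneg _)
  rw [← hbc] at h2
  exact le_of_mul_le_mul_right (h1.trans ((hU x x.2).trans h2)) hpos

open Matrix in
/-- The singular values of `U * diagonal d * Wᵀ` with `U`, `W` orthogonal are the `|d i|`, up to
order. -/
lemma sum_singVals_eq {N : ℕ} {U W : Matrix (Fin N) (Fin N) ℝ} (hU : Uᵀ * U = 1) (hW : Wᵀ * W = 1)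
    (d : Fin N → ℝ) (f : ℝ → ℝ) :
    ∑ i, f (singVals (U * diagonal d * Wᵀ) i) = ∑ i, f |d i| := by
  set X := U * diagonal d * Wᵀ
  have hX : Xᴴ * X = W * diagonal (fun i => d i ^ 2) * Wᵀ := by
    have : Xᴴ * X = W * diagonal d * (Uᵀ * U) * diagonal d * Wᵀ := by
      simp only [X, conjTranspose_eq_transpose_of_trivial, transpose_mul, transpose_transpose,
        diagonal_transpose, Matrix.mul_assoc]
    rw [this, hU, Matrix.mul_one, Matrix.mul_assoc W, diagonal_mul_diagonal]
    simp only [pow_two]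
  have hchar : (Xᴴ * X).charpoly = ∏ i, (Polynomial.X - Polynomial.C (d i ^ 2)) := by
    rw [hX, charpoly_mul_comm, ← Matrix.mul_assoc, hW, Matrix.one_mul, charpoly_diagonal]
  have hroots := (isHermitian_conjTranspose_mul_self X).roots_charpoly_eq_eigenvalues
  have hprod : ∏ i, (Polynomial.X - Polynomial.C (d i ^ 2)) =
      ((Finset.univ.val.map fun i => d i ^ 2).map fun a => Polynomial.X - Polynomial.C a).prod := by
    rw [Multiset.map_map]
    rfl
  rw [hchar, hprod, Polynomial.roots_multiset_prod_X_sub_C] at hroots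
  have h := congrArg (fun s : Multiset ℝ => (s.map fun x => f √x).sum) hroots
  simp only [Multiset.map_map] at h
  refine Eq.trans h.symm ?_
  exact Finset.sum_congr rfl fun i _ => congrArg f (Real.sqrt_sq_eq_abs (d i))

/-- A singular value decomposition with nonincreasing singular values. -/
structure IsSVD {N : ℕ} (X U W : Matrix (Fin N) (Fin N) ℝ) (σ : Fin N → ℝ) : Prop where
  left_orth : U.transpose * U = 1
  right_orth : W.transpose * W = 1
  nonneg : ∀ i, 0 ≤ σ i
  anti : Antitone σ
  eq : X = U * Matrix.diagonal σ * W.transpose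

lemma exists_equiv_antitone_comp {ι : Type*} [Fintype ι] {n : ℕ} (hn : Fintype.card ι = n)
    (f : ι → ℝ) : ∃ e : Fin n ≃ ι, Antitone (f ∘ e) := by
  let e := (Fintype.equivFinOfCardEq hn).symm
  refine ⟨(Tuple.sort fun i => -f (e i)).trans e, fun i j hij => ?_⟩
  have := Tuple.monotone_sort (fun i => -f (e i)) hij
  simpa using this

open Matrix in
lemma exists_isSVD {N : ℕ} (X : Matrix (Fin N) (Fin N) ℝ) : ∃ U W σ, IsSVD X U W σ := by
  let hH := isHermitian_conjTranspose_mul_self X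
  obtain ⟨e, he⟩ := exists_equiv_antitone_comp (Fintype.card_fin N) hH.eigenvalues
  let w := hH.eigenvectorBasis.reindex e.symm
  let μ : Fin N → ℝ := hH.eigenvalues ∘ e
  have hμ0 : ∀ i, 0 ≤ μ i := fun i => (posSemidef_conjTranspose_mul_self X).eigenvalues_nonneg _
  let σ : Fin N → ℝ := fun i => √(μ i)
  let T := X.toEuclideanLin
  have hTw : ∀ i, (Xᴴ).toEuclideanLin (T (w i)) = μ i • w i := by
    intro i
    have := hH.mulVec_eigenvectorBasis (e i)
    apply PiLp.ext
    intro k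
    simpa [T, w, μ, Matrix.mulVec_mulVec] using congrFun this k
  have hinner : ∀ i j, inner ℝ (T (w i)) (T (w j)) = if i = j then μ j else 0 := by
    intro i j
    have h1 : inner ℝ (T (w i)) (T (w j)) = inner ℝ (w i) ((Xᴴ).toEuclideanLin (T (w j))) := by
      rw [Matrix.toEuclideanLin_conjTranspose_eq_adjoint, LinearMap.adjoint_inner_right]
    rw [h1, hTw, inner_smul_right, orthonormal_iff_ite.1 w.orthonormal]
    simp
  obtain ⟨u, hu⟩ := Orthonormal.exists_orthonormalBasis_extension_of_card_eq (𝕜 := ℝ)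
    (E := EuclideanSpace ℝ (Fin N)) (ι := Fin N) (by simp) (v := fun i => (σ i)⁻¹ • T (w i)) (s := {i | σ i ≠ 0}) (by
      rw [orthonormal_iff_ite]
      rintro ⟨i, hi⟩ ⟨j, hj⟩
      simp only [Set.domRestrict_apply, Subtype.mk.injEq, inner_smul_left, inner_smul_right, hinner]
      split_ifs with hij
      · subst hij
        have : σ i * σ i = μ i := Real.mul_self_sqrt (hμ0 i)
        rw [← this]
        have hi' : σ i ≠ 0 := hi
        simp
        field_simp
      · simp)
  have hTu : ∀ i, T (w i) = σ i • u i := by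
    intro i
    by_cases hi : σ i = 0
    · have : inner ℝ (T (w i)) (T (w i)) = 0 := by
        rw [hinner, if_pos rfl, ← Real.mul_self_sqrt (hμ0 i)]
        simp only [σ] at hi
        rw [hi, zero_mul]
      rw [inner_self_eq_zero.1 this, hi, zero_smul]
    · rw [hu i hi, smul_smul, mul_inv_cancel₀ hi, one_smul]
  have horth : ∀ v : OrthonormalBasis (Fin N) ℝ (EuclideanSpace ℝ (Fin N)),
      (Matrix.of fun i j => v j i)ᵀ * (Matrix.of fun i j => v j i) = 1 := by
    intro v
    ext i j
    have := orthonormal_iff_ite.1 v.orthonormal j i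
    rw [Matrix.one_apply, Matrix.mul_apply]
    simp only [transpose_apply, of_apply]
    rw [PiLp.inner_apply] at this
    simp only [RCLike.inner_apply, conj_trivial] at this
    rw [this]
    simp [eq_comm]
  refine ⟨.of fun i j => u j i, .of fun i j => w j i, σ, horth u, horth w,
    fun i => Real.sqrt_nonneg _, fun i j hij => Real.sqrt_le_sqrt (he hij), ?_⟩
  have hW := mul_eq_one_comm.1 (horth w)
  have hXW : X * (Matrix.of fun i j => w j i) = (Matrix.of fun i j => u j i) * diagonal σ := by
    ext i j
    have := congrArg (fun z : EuclideanSpace ℝ (Fin N) => z i) (hTu j)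
    rw [mul_diagonal, of_apply, mul_comm]
    simpa [T, Matrix.mul_apply, Matrix.mulVec, dotProduct] using this
  rw [← hXW, Matrix.mul_assoc, hW, Matrix.mul_one]

open Matrix in
lemma IsSVD.sum_singVals {N : ℕ} {X U W : Matrix (Fin N) (Fin N) ℝ} {σ : Fin N → ℝ}
    (h : IsSVD X U W σ) (f : ℝ → ℝ) : ∑ i, f (singVals X i) = ∑ i, f (σ i) := by
  rw [h.eq, sum_singVals_eq h.left_orth h.right_orth]
  simp [abs_of_nonneg (h.nonneg _)]

open Matrix in
/-- Diagonalisation of a symmetric matrix with nonincreasing eigenvalues, as a quadratic form. -/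
lemma exists_antitone_diagonalization {ι : Type*} [Fintype ι] [DecidableEq ι] {n : ℕ}
    (hn : Fintype.card ι = n) {H : Matrix ι ι ℝ} (hH : H.IsHermitian) :
    ∃ (μ : Fin n → ℝ) (c : (ι → ℝ) →ₗ[ℝ] Fin n → ℝ), Antitone μ ∧ ∑ i, μ i = H.trace ∧
      (∀ x, ∑ l, c x l ^ 2 = ∑ l, x l ^ 2) ∧ ∀ x, ∑ l, μ l * c x l ^ 2 = x ⬝ᵥ (H *ᵥ x) := by
  obtain ⟨e, he⟩ := exists_equiv_antitone_comp hn hH.eigenvalues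
  let b := hH.eigenvectorBasis
  refine ⟨hH.eigenvalues ∘ e, (LinearMap.funLeft ℝ ℝ e).comp
    ((WithLp.linearEquiv 2 ℝ (ι → ℝ)).toLinearMap.comp
      (b.repr.toLinearEquiv.toLinearMap.comp (WithLp.linearEquiv 2 ℝ (ι → ℝ)).symm.toLinearMap)),
      he, ?_, fun x => ?_, fun x => ?_⟩
  · rw [hH.trace_eq_sum_eigenvalues]
    exact Equiv.sum_comp e hH.eigenvalues
  · have h := b.sum_sq_norm_inner_right (WithLp.toLp 2 x)
    rw [EuclideanSpace.norm_sq_eq] at h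
    refine Eq.trans (Equiv.sum_comp e fun l => (b.repr (WithLp.toLp 2 x)).ofLp l ^ 2) ?_
    simpa [b.repr_apply_apply] using h
  · refine Eq.trans (Equiv.sum_comp e fun l => hH.eigenvalues l * (b.repr (WithLp.toLp 2 x)).ofLp l ^ 2) ?_
    have h := b.sum_inner_mul_inner (WithLp.toLp 2 x) (toEuclideanLin H (WithLp.toLp 2 x))
    have h2 : ∀ l, inner ℝ (b l) (toEuclideanLin H (WithLp.toLp 2 x)) =
        hH.eigenvalues l * inner ℝ (b l) (WithLp.toLp 2 x) := by
      intro l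
      rw [← (isSymmetric_toEuclideanLin_iff.mpr hH)]
      have : toEuclideanLin H (b l) = hH.eigenvalues l • b l := by
        apply PiLp.ext
        intro k
        simpa using congrFun (hH.mulVec_eigenvectorBasis l) k
      rw [this, inner_smul_left]; simp
    simp only [h2] at h
    have h3 : inner ℝ (WithLp.toLp 2 x) (toEuclideanLin H (WithLp.toLp 2 x)) = x ⬝ᵥ (H *ᵥ x) := by
      simp [PiLp.inner_apply, dotProduct, mul_comm]
    rw [← h3, ← h]
    refine Finset.sum_congr rfl fun l _ => ?_
    rw [b.repr_apply_apply, real_inner_comm (b l)]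
    ring

section Perturbation

open Matrix

variable {N : ℕ}

lemma sum_sq_transpose_mulVec {W : Matrix (Fin N) (Fin N) ℝ} (hW : Wᵀ * W = 1) (x : Fin N → ℝ) :
    ∑ l, (Wᵀ *ᵥ x) l ^ 2 = ∑ l, x l ^ 2 := by
  have h : (Wᵀ *ᵥ x) ⬝ᵥ (Wᵀ *ᵥ x) = x ⬝ᵥ x := by
    rw [dotProduct_mulVec, vecMul_transpose, mulVec_mulVec, mul_eq_one_comm.1 hW, one_mulVec]
  simpa only [dotProduct, ← pow_two] using h

lemma IsSVD.dotProduct_mulVec {X U W : Matrix (Fin N) (Fin N) ℝ} {σ : Fin N → ℝ}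
    (h : IsSVD X U W σ) (x y : Fin N → ℝ) :
    x ⬝ᵥ (X *ᵥ y) = ∑ l, σ l * ((Uᵀ *ᵥ x) l * (Wᵀ *ᵥ y) l) := by
  have : x ⬝ᵥ (X *ᵥ y) = (Uᵀ *ᵥ x) ⬝ᵥ (diagonal σ *ᵥ (Wᵀ *ᵥ y)) := by
    rw [mulVec_transpose, ← Matrix.dotProduct_mulVec, mulVec_mulVec, mulVec_mulVec, ← h.eq]
  rw [this, dotProduct]
  refine Finset.sum_congr rfl fun l _ => ?_
  rw [mulVec_diagonal]
  ring

lemma IsSVD.sum_sq_mulVec {X U W : Matrix (Fin N) (Fin N) ℝ} {σ : Fin N → ℝ}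
    (h : IsSVD X U W σ) (x : Fin N → ℝ) :
    ∑ l, (X *ᵥ x) l ^ 2 = ∑ l, σ l ^ 2 * (Wᵀ *ᵥ x) l ^ 2 := by
  have h1 : Uᵀ *ᵥ (X *ᵥ x) = diagonal σ *ᵥ (Wᵀ *ᵥ x) := by
    rw [h.eq, mulVec_mulVec, ← Matrix.mul_assoc, ← Matrix.mul_assoc, h.left_orth, Matrix.one_mul,
      mulVec_mulVec]
  rw [← sum_sq_transpose_mulVec h.left_orth, h1]
  refine Finset.sum_congr rfl fun l _ => ?_
  rw [mulVec_diagonal]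
  ring

/-- Singular values of two matrices which agree on a subspace of codimension `k`. -/
lemma IsSVD.le_of_eqOn {X U W Y U' W' : Matrix (Fin N) (Fin N) ℝ} {σ τ : Fin N → ℝ}
    (hX : IsSVD X U W σ) (hY : IsSVD Y U' W' τ) {k : ℕ} (S : Submodule ℝ (Fin N → ℝ))
    (hS : N ≤ Module.finrank ℝ S + k) (hXY : ∀ x ∈ S, X *ᵥ x = Y *ᵥ x) {i j : Fin N}
    (hij : (i : ℕ) + k ≤ j) : σ j ≤ τ i := by
  have hsq : σ j ^ 2 ≤ τ i ^ 2 := by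
    refine le_of_quadratic_le (Wᵀ).mulVecLin (W'ᵀ).mulVecLin ?_ (fun x => ?_) (fun l => σ l ^ 2)
      (fun l => τ l ^ 2) S (fun x hx => ?_) (Finset.Ioi j) (Finset.Iio i) (fun l hl => ?_)
      (fun l hl => ?_) ?_
    · refine Function.LeftInverse.injective (g := W.mulVecLin) fun x => ?_
      rw [mulVecLin_apply, mulVecLin_apply, mulVec_mulVec, mul_eq_one_comm.1 hX.right_orth,
        one_mulVec]
    · simp only [mulVecLin_apply]
      rw [sum_sq_transpose_mulVec hX.right_orth, sum_sq_transpose_mulVec hY.right_orth]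
    · simp only [mulVecLin_apply]
      rw [← hX.sum_sq_mulVec, ← hY.sum_sq_mulVec, hXY x hx]
    · exact pow_le_pow_left₀ (hX.nonneg j) (hX.anti (by simpa using hl)) 2
    · exact pow_le_pow_left₀ (hY.nonneg l) (hY.anti (by simpa using hl)) 2
    · rw [Fin.card_Ioi, Fin.card_Iio]
      omega
  exact (pow_le_pow_iff_left₀ (hX.nonneg j) (hY.nonneg i) two_ne_zero).1 hsq

lemma IsSVD.le_of_rank_le {X Y U W U' W' : Matrix (Fin N) (Fin N) ℝ} {σ τ : Fin N → ℝ} {k : ℕ}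
    (hY : (X - Y).rank ≤ k) (hX : IsSVD X U W σ) (hXY : IsSVD Y U' W' τ) {i j : Fin N}
    (hij : (i : ℕ) + k ≤ j) : σ j ≤ τ i := by
  refine hX.le_of_eqOn hXY (LinearMap.ker (X - Y).mulVecLin) ?_ (fun x hx => ?_) hij
  · have := (X - Y).mulVecLin.finrank_range_add_finrank_ker
    rw [Module.finrank_fin_fun] at this
    rw [Matrix.rank] at hY
    omega
  · rw [LinearMap.mem_ker, mulVecLin_apply, sub_mulVec] at hx
    exact sub_eq_zero.1 hx

/-- Singular values of `X` below sorted eigenvalues of any form dominating the Hermitian dilation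
of `X`. -/
lemma IsSVD.le_of_dilation_le {X U W : Matrix (Fin N) (Fin N) ℝ} {σ : Fin N → ℝ}
    (hX : IsSVD X U W σ) (μ : Fin (N + N) → ℝ) (hμ : Antitone μ)
    (c : (Fin N ⊕ Fin N → ℝ) →ₗ[ℝ] Fin (N + N) → ℝ) (hc : ∀ x, ∑ l, c x l ^ 2 = ∑ l, x l ^ 2)
    (hle : ∀ x : Fin N ⊕ Fin N → ℝ,
      2 * ((x ∘ Sum.inl) ⬝ᵥ (X *ᵥ (x ∘ Sum.inr))) ≤ ∑ l, μ l * c x l ^ 2) (i : Fin N) :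
    σ i ≤ μ (i.castAdd N) ∧ -σ i ≤ μ (i.castAdd N).rev := by
  let xl : (Fin N ⊕ Fin N → ℝ) →ₗ[ℝ] Fin N → ℝ := (Uᵀ).mulVecLin.comp (LinearMap.funLeft ℝ ℝ Sum.inl)
  let xr : (Fin N ⊕ Fin N → ℝ) →ₗ[ℝ] Fin N → ℝ := (Wᵀ).mulVecLin.comp (LinearMap.funLeft ℝ ℝ Sum.inr)
  let b : (Fin N ⊕ Fin N → ℝ) →ₗ[ℝ] Fin N ⊕ Fin N → ℝ :=
    LinearMap.pi (Sum.elim (fun l => (√2)⁻¹ • ((LinearMap.proj l).comp (xl + xr)))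
      (fun l => (√2)⁻¹ • ((LinearMap.proj l).comp (xl - xr))))
  have hl : ∀ x l, b x (Sum.inl l) = (√2)⁻¹ * (xl x l + xr x l) := fun x l => rfl
  have hr : ∀ x l, b x (Sum.inr l) = (√2)⁻¹ * (xl x l - xr x l) := fun x l => rfl
  have hs2 : (√2)⁻¹ ^ 2 = (1 / 2 : ℝ) := by rw [inv_pow, Real.sq_sqrt zero_le_two]; norm_num
  have hbsq : ∀ x, ∑ l, b x l ^ 2 = ∑ l, x l ^ 2 := by
    intro x
    have h1 : ∑ l, xl x l ^ 2 = ∑ l, x (Sum.inl l) ^ 2 := sum_sq_transpose_mulVec hX.left_orth _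
    have h2 : ∑ l, xr x l ^ 2 = ∑ l, x (Sum.inr l) ^ 2 := sum_sq_transpose_mulVec hX.right_orth _
    rw [Fintype.sum_sum_type, Fintype.sum_sum_type, ← h1, ← h2, ← Finset.sum_add_distrib,
      ← Finset.sum_add_distrib]
    refine Finset.sum_congr rfl fun l _ => ?_
    rw [hl, hr, mul_pow, mul_pow, hs2]
    ring
  have hinj : Function.Injective b := by
    rw [injective_iff_map_eq_zero]
    intro x hx
    have h1 := hbsq x
    rw [hx] at h1
    simp only [Pi.zero_apply, ne_eq, OfNat.ofNat_ne_zero, not_false_eq_true, zero_pow,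
      Finset.sum_const_zero] at h1
    have h2 := (Finset.sum_eq_zero_iff_of_nonneg fun l _ => sq_nonneg (x l)).1 h1.symm
    funext l
    exact pow_eq_zero_iff two_ne_zero |>.1 (h2 l (Finset.mem_univ l))
  have hform : ∀ x, ∑ l, Sum.elim σ (-σ) l * b x l ^ 2 =
      2 * ((x ∘ Sum.inl) ⬝ᵥ (X *ᵥ (x ∘ Sum.inr))) := by
    intro x
    have h1 : (x ∘ Sum.inl) ⬝ᵥ (X *ᵥ (x ∘ Sum.inr)) = ∑ l, σ l * (xl x l * xr x l) :=
      hX.dotProduct_mulVec _ _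
    rw [h1, Fintype.sum_sum_type, ← Finset.sum_add_distrib, Finset.mul_sum]
    refine Finset.sum_congr rfl fun l _ => ?_
    rw [hl, hr, mul_pow, mul_pow, hs2]
    simp only [Sum.elim_inl, Sum.elim_inr, Pi.neg_apply]
    ring
  constructor
  · refine le_of_quadratic_le b c hinj (fun x => (hbsq x).trans (hc x).symm) (Sum.elim σ (-σ)) μ ⊤
      (fun x _ => (hform x).trans_le (hle x)) ((Finset.Ioi i).disjSum Finset.univ)
      (Finset.Iio (i.castAdd N)) ?_ (fun l hl => hμ (by simpa using hl)) ?_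
    · rintro (l | l) hl
      · exact hX.anti (by simpa using hl)
      · simp at hl
    · rw [finrank_top, Finset.card_disjSum, Fin.card_Ioi, Fin.card_Iio]
      simp
      omega
  · refine le_of_quadratic_le b c hinj (fun x => (hbsq x).trans (hc x).symm) (Sum.elim σ (-σ)) μ ⊤
      (fun x _ => (hform x).trans_le (hle x)) ((∅ : Finset (Fin N)).disjSum (Finset.Iio i))
      (Finset.Iio (i.castAdd N).rev) ?_ (fun l hl => hμ (by simpa using hl)) ?_
    · rintro (l | l) hl
      · exact (neg_nonpos.2 (hX.nonneg i)).trans (hX.nonneg l)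
      · exact neg_le_neg (hX.anti (by simpa using hl))
    · rw [finrank_top, Finset.card_disjSum, Fin.card_Iio, Fin.card_Iio]
      simp
      omega

/-- Singular values under a rank-one perturbation of norm `τ` move by at most `τ` in total. -/
lemma IsSVD.sum_abs_sub_le {A B U W U' W' : Matrix (Fin N) (Fin N) ℝ} {a b : Fin N → ℝ}
    (hA : IsSVD A U W a) (hB : IsSVD B U' W' b) {τ : ℝ} (hτ : 0 ≤ τ) {u v : Fin N → ℝ}
    (hu : u ⬝ᵥ u = 1) (hv : v ⬝ᵥ v = 1) (hAB : A = B + τ • vecMulVec u v) :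
    ∑ i, |a i - b i| ≤ τ := by
  let w : Fin N ⊕ Fin N → ℝ := Sum.elim u v
  let H : Matrix (Fin N ⊕ Fin N) (Fin N ⊕ Fin N) ℝ := fromBlocks 0 B Bᵀ 0 + (τ / 2) • vecMulVec w w
  have hH : H.IsHermitian := by
    rw [isHermitian_iff_isSymm, Matrix.IsSymm]
    simp only [H, transpose_add, transpose_smul, transpose_vecMulVec, fromBlocks_transpose,
      transpose_zero, transpose_transpose]
  have hform : ∀ x : Fin N ⊕ Fin N → ℝ, x ⬝ᵥ (H *ᵥ x) =
      2 * ((x ∘ Sum.inl) ⬝ᵥ (B *ᵥ (x ∘ Sum.inr))) +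
        τ / 2 * (u ⬝ᵥ (x ∘ Sum.inl) + v ⬝ᵥ (x ∘ Sum.inr)) ^ 2 := by
    intro x
    have hw : w ⬝ᵥ x = u ⬝ᵥ (x ∘ Sum.inl) + v ⬝ᵥ (x ∘ Sum.inr) := by
      simp [w, dotProduct]
    have h1 : x ⬝ᵥ (fromBlocks 0 B Bᵀ 0 *ᵥ x) = 2 * ((x ∘ Sum.inl) ⬝ᵥ (B *ᵥ (x ∘ Sum.inr))) := by
      have h2 : x ⬝ᵥ (fromBlocks 0 B Bᵀ 0 *ᵥ x) = (x ∘ Sum.inl) ⬝ᵥ (B *ᵥ (x ∘ Sum.inr)) +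
          (x ∘ Sum.inr) ⬝ᵥ (Bᵀ *ᵥ (x ∘ Sum.inl)) := by
        rw [fromBlocks_mulVec]
        simp [dotProduct]
      rw [h2, mulVec_transpose, dotProduct_comm (x ∘ Sum.inr), ← Matrix.dotProduct_mulVec]
      ring
    rw [add_mulVec, dotProduct_add, h1, smul_mulVec, vecMulVec_mulVec, dotProduct_smul,
      ← hw]
    simp only [op_smul_eq_smul, dotProduct_smul, smul_eq_mul, dotProduct_comm x w]
    ring
  have htrace : H.trace = τ := by
    have htr : (fromBlocks 0 B Bᵀ 0).trace = 0 := by simp [Matrix.trace]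
    simp only [H, trace_add, trace_smul, htr, trace_vecMulVec]
    have : w ⬝ᵥ w = u ⬝ᵥ u + v ⬝ᵥ v := by simp [w, dotProduct]
    rw [this, hu, hv, smul_eq_mul]
    ring
  obtain ⟨μ, c, hμ, hsum, hc, hcH⟩ := exists_antitone_diagonalization
    (show Fintype.card (Fin N ⊕ Fin N) = N + N by simp) hH
  have hBle := hB.le_of_dilation_le μ hμ c hc fun x => by
    rw [hcH, hform]
    have : 0 ≤ τ / 2 * (u ⬝ᵥ (x ∘ Sum.inl) + v ⬝ᵥ (x ∘ Sum.inr)) ^ 2 := by positivity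
    linarith
  have hAle := hA.le_of_dilation_le μ hμ c hc fun x => by
    rw [hcH, hform, hAB, add_mulVec, dotProduct_add, smul_mulVec, vecMulVec_mulVec,
      dotProduct_smul]
    simp only [op_smul_eq_smul, dotProduct_smul, smul_eq_mul,
      dotProduct_comm (x ∘ Sum.inl) u]
    have : 0 ≤ τ / 2 * (u ⬝ᵥ (x ∘ Sum.inl) - v ⬝ᵥ (x ∘ Sum.inr)) ^ 2 := by positivity
    linarith
  have hsum' : ∑ i : Fin N, (μ (i.castAdd N) + μ (i.castAdd N).rev) = τ := by
    rw [← htrace, ← hsum, Fin.sum_univ_add, Finset.sum_add_distrib,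
      ← Equiv.sum_comp Fin.revPerm fun i : Fin N => μ (Fin.natAdd N i)]
    congr 1
    refine Finset.sum_congr rfl fun i _ => congrArg μ ?_
    ext
    simp
    omega
  rw [← hsum']
  refine Finset.sum_le_sum fun i _ => ?_
  obtain ⟨h1, h2⟩ := hAle i
  obtain ⟨h3, h4⟩ := hBle i
  rw [abs_le]
  constructor <;> linarith

lemma IsSVD.unique {X U W U' W' : Matrix (Fin N) (Fin N) ℝ} {σ τ : Fin N → ℝ}
    (h : IsSVD X U W σ) (h' : IsSVD X U' W' τ) : σ = τ := by
  funext i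
  exact le_antisymm (h.le_of_rank_le (k := 0) (by simp) h' le_rfl)
    (h'.le_of_rank_le (k := 0) (by simp) h le_rfl)

lemma IsSVD.sum_abs_rpow_sub_le_of_rank_one {p : ℝ} (hp0 : 0 < p) (hp1 : p ≤ 1)
    {A B U W U' W' : Matrix (Fin N) (Fin N) ℝ} {a b : Fin N → ℝ}
    (hA : IsSVD A U W a) (hB : IsSVD B U' W' b) {τ : ℝ} (hτ : 0 ≤ τ) {u v : Fin N → ℝ}
    (hu : u ⬝ᵥ u = 1) (hv : v ⬝ᵥ v = 1) (hAB : A = B + τ • vecMulVec u v) :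
    ∑ i, |a i ^ p - b i ^ p| ≤ τ ^ p := by
  have hrank : (A - B).rank ≤ 1 := by
    rw [hAB, add_sub_cancel_left, ← smul_vecMulVec]
    exact rank_vecMulVec_le _ _
  have hrank' : (B - A).rank ≤ 1 := by
    rw [hAB, sub_add_cancel_left, ← neg_smul, ← smul_vecMulVec]
    exact rank_vecMulVec_le _ _
  refine (sum_abs_rpow_sub_le hp0 hp1 a b (M := ∑ i, a i + ∑ i, b i)
    (add_nonneg (Finset.sum_nonneg fun i _ => hA.nonneg i)
      (Finset.sum_nonneg fun i _ => hB.nonneg i)) hA.nonneg hB.nonneg (fun i => ?_) (fun i => ?_)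
    fun i j hij => ?_).2.trans
    (Real.rpow_le_rpow (Finset.sum_nonneg fun _ _ => abs_nonneg _)
      (hA.sum_abs_sub_le hB hτ hu hv hAB) hp0.le)
  · exact (Finset.single_le_sum (fun i _ => hA.nonneg i) (Finset.mem_univ i)).trans
      (le_add_of_nonneg_right (Finset.sum_nonneg fun i _ => hB.nonneg i))
  · exact (Finset.single_le_sum (fun i _ => hB.nonneg i) (Finset.mem_univ i)).trans
      (le_add_of_nonneg_left (Finset.sum_nonneg fun i _ => hA.nonneg i))
  · exact max_le (le_min (hA.anti hij.le) (hA.le_of_rank_le hrank hB hij))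
      (le_min (hB.le_of_rank_le hrank' hA hij) (hB.anti hij.le))

/-- Mirsky's inequality for the concave function `x ↦ x ^ p`. -/
lemma IsSVD.sum_abs_rpow_sub_le {p : ℝ} (hp0 : 0 < p) (hp1 : p ≤ 1)
    {A B Z U₁ W₁ U₂ W₂ U W : Matrix (Fin N) (Fin N) ℝ} {a b ζ : Fin N → ℝ}
    (hA : IsSVD A U₁ W₁ a) (hB : IsSVD B U₂ W₂ b) (hZ : IsSVD Z U W ζ) (hABZ : A = B + Z) :
    ∑ i, |a i ^ p - b i ^ p| ≤ ∑ i, ζ i ^ p := by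
  have hcol : ∀ {Q : Matrix (Fin N) (Fin N) ℝ}, Qᵀ * Q = 1 → ∀ j, Q.col j ⬝ᵥ Q.col j = 1 := by
    intro Q hQ j
    have := congrFun (congrFun hQ j) j
    rwa [Matrix.one_apply_eq] at this
  have hZsum : Z = ∑ j, ζ j • vecMulVec (U.col j) (W.col j) := by
    ext i k
    rw [hZ.eq, Matrix.mul_apply, Matrix.sum_apply]
    refine Finset.sum_congr rfl fun j _ => ?_
    simp only [mul_diagonal, transpose_apply, Matrix.smul_apply, vecMulVec_apply, col_apply, smul_eq_mul]
    ring
  have key : ∀ (S : Finset (Fin N)) (C U' W' : Matrix (Fin N) (Fin N) ℝ) (c : Fin N → ℝ),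
      IsSVD C U' W' c → C = B + ∑ j ∈ S, ζ j • vecMulVec (U.col j) (W.col j) →
      ∑ i, |c i ^ p - b i ^ p| ≤ ∑ j ∈ S, ζ j ^ p := by
    intro S
    induction S using Finset.induction_on with
    | empty =>
      intro C U' W' c hC hCB
      rw [Finset.sum_empty, add_zero] at hCB
      subst hCB
      simp [hC.unique hB]
    | insert j S hj ih =>
      intro C U' W' c hC hCB
      obtain ⟨U₃, W₃, d, hD⟩ :=
        exists_isSVD (B + ∑ j ∈ S, ζ j • vecMulVec (U.col j) (W.col j))
      rw [Finset.sum_insert hj, add_left_comm, add_comm] at hCB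
      have h1 := hC.sum_abs_rpow_sub_le_of_rank_one hp0 hp1 hD (hZ.nonneg j)
        (hcol hZ.left_orth j) (hcol hZ.right_orth j) hCB
      have h2 := ih _ _ _ _ hD rfl
      rw [Finset.sum_insert hj]
      refine le_trans ?_ (add_le_add h1 h2)
      rw [← Finset.sum_add_distrib]
      exact Finset.sum_le_sum fun i _ => abs_sub_le _ _ _
  exact key Finset.univ A U₁ W₁ a hA (by rw [hABZ, ← hZsum])

end Perturbation

section RestrictedIsometry

variable {E F : Type*} [NormedAddCommGroup E] [InnerProductSpace ℝ E] [NormedAddCommGroup F]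
  [InnerProductSpace ℝ F]

/-- Almost orthogonality of the images of orthogonal vectors under a restricted isometry. -/
lemma inner_map_le_of_orthogonal (B : E →ₗ[ℝ] F) {α β : ℝ} (hα : 0 ≤ α) {x y : E}
    (hxy : inner ℝ x y = 0) (hlow : ∀ a b : ℝ, α * ‖a • x + b • y‖ ≤ ‖B (a • x + b • y)‖)
    (hup : ∀ a b : ℝ, ‖B (a • x + b • y)‖ ≤ β * ‖a • x + b • y‖) :
    inner ℝ (B x) (B y) ≤ (β ^ 2 - α ^ 2) / 2 * (‖x‖ * ‖y‖) := by
  rcases eq_or_ne x 0 with rfl | hx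
  · simp
  rcases eq_or_ne y 0 with rfl | hy
  · simp
  have hpos : 0 < ‖x‖ * ‖y‖ := mul_pos (norm_pos_iff.2 hx) (norm_pos_iff.2 hy)
  have hnorm : ∀ a b : ℝ, ‖a • x + b • y‖ ^ 2 = a ^ 2 * ‖x‖ ^ 2 + b ^ 2 * ‖y‖ ^ 2 := by
    intro a b
    rw [norm_add_sq_real, inner_smul_left, inner_smul_right, hxy, norm_smul, norm_smul, mul_pow,
      mul_pow, Real.norm_eq_abs, Real.norm_eq_abs, sq_abs, sq_abs]
    simp
  have hnormB : ∀ a b : ℝ, ‖B (a • x + b • y)‖ ^ 2 =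
      a ^ 2 * ‖B x‖ ^ 2 + 2 * (a * b) * inner ℝ (B x) (B y) + b ^ 2 * ‖B y‖ ^ 2 := by
    intro a b
    rw [map_add, map_smul, map_smul, norm_add_sq_real, inner_smul_left, inner_smul_right,
      norm_smul, norm_smul, mul_pow, mul_pow, Real.norm_eq_abs, Real.norm_eq_abs, sq_abs, sq_abs]
    simp only [conj_trivial]
    ring
  have h1 := pow_le_pow_left₀ (norm_nonneg _) (hup ‖y‖ ‖x‖) 2
  have h2 := pow_le_pow_left₀ (mul_nonneg hα (norm_nonneg _)) (hlow ‖y‖ (-‖x‖)) 2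
  rw [mul_pow, hnorm, hnormB] at h1 h2
  refine le_of_mul_le_mul_left ?_ hpos
  linarith

lemma le_of_sq_add_sq_le {a b M : ℝ} (hM : 0 ≤ M) (h : a ^ 2 + b ^ 2 ≤ M * (a + b)) :
    a ≤ (1 + √2) / 2 * M := by
  have h1 : (a - M / 2) ^ 2 ≤ (√2 / 2 * M) ^ 2 := by
    rw [mul_pow, div_pow, Real.sq_sqrt zero_le_two]
    nlinarith [sq_nonneg (b - M / 2)]
  have h2 := abs_le_of_sq_le_sq' h1 (by positivity)
  linarith [h2.2]

/-- The two leading blocks of a vector are controlled by its image and by the remaining blocks. -/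
lemma norm_leading_blocks_le (B : E →ₗ[ℝ] F) {α β : ℝ} (hα : 0 < α) (hαβ : α ≤ β) {x₀ x₁ v : E}
    {K : Type*} (S : Finset K) (z : K → E) (hv : v = x₀ + x₁ + ∑ k ∈ S, z k)
    (h01 : inner ℝ x₀ x₁ = 0) (hlow : α * ‖x₀ + x₁‖ ≤ ‖B (x₀ + x₁)‖)
    (hup₀ : ‖B x₀‖ ≤ β * ‖x₀‖) (hup₁ : ‖B x₁‖ ≤ β * ‖x₁‖)
    (hz₀ : ∀ k ∈ S, inner ℝ (B (-z k)) (B x₀) ≤ (β ^ 2 - α ^ 2) / 2 * (‖z k‖ * ‖x₀‖))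
    (hz₁ : ∀ k ∈ S, inner ℝ (B (-z k)) (B x₁) ≤ (β ^ 2 - α ^ 2) / 2 * (‖z k‖ * ‖x₁‖)) {θ : ℝ}
    (hθ : 0 ≤ θ) (hBv : ‖B v‖ ≤ 2 * β * θ) :
    ‖x₀‖ ≤ (1 + √2) / 2 * (2 * (β ^ 2 / α ^ 2) * θ + (β ^ 2 / α ^ 2 - 1) / 2 * ∑ k ∈ S, ‖z k‖) ∧
    ‖x₁‖ ≤ (1 + √2) / 2 * (2 * (β ^ 2 / α ^ 2) * θ + (β ^ 2 / α ^ 2 - 1) / 2 * ∑ k ∈ S, ‖z k‖) := by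
  have hβ : 0 < β := hα.trans_le hαβ
  set M := 2 * (β ^ 2 / α ^ 2) * θ + (β ^ 2 / α ^ 2 - 1) / 2 * ∑ k ∈ S, ‖z k‖ with hMdef
  have hγ : 0 ≤ β ^ 2 / α ^ 2 - 1 := by
    rw [sub_nonneg, one_le_div (by positivity)]
    exact pow_le_pow_left₀ hα.le hαβ 2
  have hM : 0 ≤ M := by positivity
  have hsq : ‖x₀ + x₁‖ ^ 2 = ‖x₀‖ ^ 2 + ‖x₁‖ ^ 2 := by
    rw [norm_add_sq_real, h01]; ring
  have hx01 : B (x₀ + x₁) = B v + ∑ k ∈ S, B (-z k) := by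
    rw [hv, map_add _ (x₀ + x₁), map_sum]
    simp
  have h1 : ‖B (x₀ + x₁)‖ ^ 2 ≤ (2 * β ^ 2 * θ + (β ^ 2 - α ^ 2) / 2 * ∑ k ∈ S, ‖z k‖) *
      (‖x₀‖ + ‖x₁‖) := by
    rw [← real_inner_self_eq_norm_sq]
    nth_rewrite 1 [hx01]
    rw [map_add, inner_add_left, sum_inner]
    have h2 : inner ℝ (B v) (B x₀ + B x₁) ≤ 2 * β ^ 2 * θ * (‖x₀‖ + ‖x₁‖) := by
      calc inner ℝ (B v) (B x₀ + B x₁) ≤ ‖B v‖ * ‖B x₀ + B x₁‖ := real_inner_le_norm _ _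
        _ ≤ (2 * β * θ) * (β * ‖x₀‖ + β * ‖x₁‖) := by
          gcongr
          exact (norm_add_le _ _).trans (add_le_add hup₀ hup₁)
        _ = _ := by ring
    have h3 : ∑ k ∈ S, inner ℝ (B (-z k)) (B x₀ + B x₁) ≤
        (β ^ 2 - α ^ 2) / 2 * (∑ k ∈ S, ‖z k‖) * (‖x₀‖ + ‖x₁‖) := by
      rw [Finset.mul_sum, Finset.sum_mul]
      refine Finset.sum_le_sum fun k hk => ?_
      rw [inner_add_right]
      linarith [hz₀ k hk, hz₁ k hk]
    linarith
  have h4 : ‖x₀‖ ^ 2 + ‖x₁‖ ^ 2 ≤ M * (‖x₀‖ + ‖x₁‖) := by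
    have h5 := pow_le_pow_left₀ (by positivity) hlow 2
    rw [mul_pow, hsq] at h5
    have h6 : α ^ 2 * (M * (‖x₀‖ + ‖x₁‖)) =
        (2 * β ^ 2 * θ + (β ^ 2 - α ^ 2) / 2 * ∑ k ∈ S, ‖z k‖) * (‖x₀‖ + ‖x₁‖) := by
      rw [hMdef]
      field_simp
    refine le_of_mul_le_mul_left ?_ (show 0 < α ^ 2 by positivity)
    rw [h6]
    exact h5.trans h1
  exact ⟨le_of_sq_add_sq_le hM h4, le_of_sq_add_sq_le (b := ‖x₀‖) hM (by linarith)⟩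

end RestrictedIsometry

section Blocks

variable {N : ℕ}

lemma sum_rpow_le_rpow_sum {ι : Type*} (S : Finset ι) {f : ι → ℝ} (hf : ∀ i ∈ S, 0 ≤ f i) {r : ℝ}
    (hr : 1 ≤ r) : ∑ i ∈ S, f i ^ r ≤ (∑ i ∈ S, f i) ^ r := by
  classical
  induction S using Finset.induction_on with
  | empty => simp [Real.zero_rpow (by linarith : r ≠ 0)]
  | insert j S hj ih =>
    rw [Finset.sum_insert hj, Finset.sum_insert hj]
    refine (add_le_add le_rfl (ih fun i hi => hf i (Finset.mem_insert_of_mem hi))).trans ?_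
    exact Real.add_rpow_le_rpow_add (hf j (Finset.mem_insert_self j S))
      (Finset.sum_nonneg fun i hi => hf i (Finset.mem_insert_of_mem hi)) hr

/-- The restriction of a vector to a set of coordinates. -/
noncomputable def restrictCoord (T : Finset (Fin N)) (v : Fin N → ℝ) : EuclideanSpace ℝ (Fin N) :=
  WithLp.toLp 2 fun i => if i ∈ T then v i else 0

lemma norm_restrictCoord_sq (T : Finset (Fin N)) (v : Fin N → ℝ) :
    ‖restrictCoord T v‖ ^ 2 = ∑ i ∈ T, v i ^ 2 := by
  rw [EuclideanSpace.norm_sq_eq]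
  simp [restrictCoord, ite_pow, Finset.sum_ite_mem]

lemma inner_restrictCoord {T T' : Finset (Fin N)} (h : Disjoint T T') (v : Fin N → ℝ) :
    inner ℝ (restrictCoord T v) (restrictCoord T' v) = 0 := by
  rw [PiLp.inner_apply]
  refine Finset.sum_eq_zero fun i _ => ?_
  by_cases hi : i ∈ T
  · simp [restrictCoord, Finset.disjoint_left.1 h hi]
  · simp [restrictCoord, hi]

/-- The `k`-th block of `t` consecutive coordinates following the first `s` ones. -/
def coordBlock (N s t k : ℕ) : Finset (Fin N) :=
  {i ∈ ({i | s ≤ i.val} : Finset (Fin N)) | (i.val - s) / t = k}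

lemma mem_coordBlock {s t k : ℕ} (ht : 0 < t) {i : Fin N} :
    i ∈ coordBlock N s t k ↔ s + k * t ≤ i ∧ i.val < s + k * t + t := by
  simp only [coordBlock, Finset.mem_filter, Finset.mem_univ, true_and, Nat.div_eq_iff ht]
  omega

lemma card_coordBlock_le (s k : ℕ) {t : ℕ} (ht : 0 < t) : (coordBlock N s t k).card ≤ t := by
  rw [← Finset.card_map Fin.valEmbedding]
  refine (Finset.card_le_card (t := Finset.Ico (s + k * t) (s + k * t + t)) fun x hx => ?_).trans
    (by simp)
  obtain ⟨i, hi, rfl⟩ := Finset.mem_map.1 hx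
  exact Finset.mem_Ico.2 ((mem_coordBlock ht).1 hi)

lemma le_card_coordBlock {s k t : ℕ} (ht : 0 < t) (h : s + k * t + t ≤ N) :
    t ≤ (coordBlock N s t k).card := by
  rw [← Finset.card_map Fin.valEmbedding]
  refine le_trans (by simp)
    (Finset.card_le_card (s := Finset.Ico (s + k * t) (s + k * t + t)) fun x hx => ?_)
  rw [Finset.mem_Ico] at hx
  exact Finset.mem_map.2 ⟨⟨x, by omega⟩, (mem_coordBlock ht).2 hx, rfl⟩

lemma disjoint_coordBlock (s t : ℕ) {k l : ℕ} (h : k ≠ l) :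
    Disjoint (coordBlock N s t k) (coordBlock N s t l) := by
  rw [Finset.disjoint_left]
  intro i hi hj
  simp only [coordBlock, Finset.mem_filter] at hi hj
  exact h (hi.2.symm.trans hj.2)

lemma sum_coordBlock {M : Type*} [AddCommMonoid M] (s t : ℕ) (f : Fin N → M) :
    ∑ k ∈ Finset.range (N + 1), ∑ i ∈ coordBlock N s t k, f i = ∑ i with s ≤ i.val, f i := by
  refine Finset.sum_fiberwise_of_maps_to (fun i _ => ?_) f
  rw [Finset.mem_range]
  exact lt_of_le_of_lt (Nat.div_le_self _ _) (by omega)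

/-- A block of a nonincreasing sequence is controlled by the preceding block. -/
lemma norm_restrictCoord_coordBlock_succ_le {p : ℝ} (hp0 : 0 < p) {v : Fin N → ℝ}
    (hv0 : ∀ i, 0 ≤ v i) (hv : Antitone v) {s t : ℕ} (ht : 0 < t) (k : ℕ) :
    ‖restrictCoord (coordBlock N s t (k + 1)) v‖ ≤
      (∑ i ∈ coordBlock N s t k, v i ^ p) ^ (1 / p) / (t : ℝ) ^ (1 / p - 1 / 2) := by
  have ht' : (0 : ℝ) < t := Nat.cast_pos.2 ht
  set Q := ∑ i ∈ coordBlock N s t k, v i ^ p with hQdef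
  have hQ : 0 ≤ Q := Finset.sum_nonneg fun i _ => Real.rpow_nonneg (hv0 i) p
  have hle : ∀ i ∈ coordBlock N s t (k + 1), v i ≤ (Q / t) ^ (1 / p) := by
    intro i hi
    rw [mem_coordBlock ht] at hi
    have hcard : t ≤ (coordBlock N s t k).card := le_card_coordBlock ht (by
      have := i.2
      have := hi.1
      rw [add_mul] at this
      omega)
    have h1 : (coordBlock N s t k).card • v i ^ p ≤ Q := by
      refine Finset.card_nsmul_le_sum _ _ _ fun j hj => ?_
      rw [mem_coordBlock ht] at hj
      refine Real.rpow_le_rpow (hv0 i) (hv ?_) hp0.le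
      rw [Fin.le_def]
      have := hi.1
      rw [add_mul] at this
      omega
    have h2 : v i ^ p ≤ Q / t := by
      rw [le_div_iff₀ ht', mul_comm]
      refine le_trans ?_ h1
      rw [nsmul_eq_mul]
      exact mul_le_mul_of_nonneg_right (Nat.cast_le.2 hcard) (Real.rpow_nonneg (hv0 i) p)
    have h3 := Real.rpow_le_rpow (Real.rpow_nonneg (hv0 i) p) h2 (one_div_pos.2 hp0).le
    rwa [← Real.rpow_mul (hv0 i), mul_one_div_cancel hp0.ne', Real.rpow_one] at h3
  have hR : 0 ≤ (Q / t) ^ (1 / p) := Real.rpow_nonneg (div_nonneg hQ ht'.le) _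
  have hsq : ‖restrictCoord (coordBlock N s t (k + 1)) v‖ ^ 2 ≤ (√t * (Q / t) ^ (1 / p)) ^ 2 := by
    rw [norm_restrictCoord_sq, mul_pow, Real.sq_sqrt ht'.le]
    refine (Finset.sum_le_card_nsmul _ _ _ fun i hi =>
      pow_le_pow_left₀ (hv0 i) (hle i hi) 2).trans ?_
    rw [nsmul_eq_mul]
    exact mul_le_mul_of_nonneg_right (Nat.cast_le.2 (card_coordBlock_le s _ ht)) (sq_nonneg _)
  refine (le_of_sq_le_sq hsq (by positivity)).trans_eq ?_
  rw [Real.div_rpow hQ ht'.le, Real.rpow_sub ht', Real.sqrt_eq_rpow]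
  have := (Real.rpow_pos_of_pos ht' (1 / p)).ne'
  have := (Real.rpow_pos_of_pos ht' (1 / 2 : ℝ)).ne'
  field_simp

lemma rpow_sum_rpow_le {p : ℝ} (hp0 : 0 < p) (hp1 : p ≤ 1) {v : Fin N → ℝ} (hv0 : ∀ i, 0 ≤ v i)
    {T : Finset (Fin N)} {s : ℕ} (hs : 0 < s) (hT : T.card ≤ s) :
    (∑ i ∈ T, v i ^ p) ^ (1 / p) ≤ (s : ℝ) ^ (1 / p - 1 / 2) * ‖restrictCoord T v‖ := by
  have hs' : (0 : ℝ) < s := Nat.cast_pos.2 hs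
  have hsum : 0 ≤ ∑ i ∈ T, v i ^ p := Finset.sum_nonneg fun i _ => Real.rpow_nonneg (hv0 i) p
  have hr : 1 ≤ 2 / p := by rw [le_div_iff₀ hp0]; linarith
  have h1 := Real.rpow_sum_le_const_mul_sum_rpow_of_nonneg T hr
    (f := fun i => v i ^ p) fun i _ => Real.rpow_nonneg (hv0 i) p
  have h2 : ∀ i, (v i ^ p) ^ (2 / p) = v i ^ 2 := by
    intro i
    rw [← Real.rpow_mul (hv0 i), mul_div_cancel₀ _ hp0.ne', Real.rpow_two]
  simp only [h2] at h1
  rw [← norm_restrictCoord_sq] at h1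
  refine le_of_sq_le_sq ?_ (by positivity)
  rw [mul_pow, ← Real.rpow_mul_natCast hsum, ← Real.rpow_mul_natCast hs'.le]
  have e1 : 1 / p * ((2 : ℕ) : ℝ) = 2 / p := by push_cast; ring
  have e2 : (1 / p - 1 / 2) * ((2 : ℕ) : ℝ) = 2 / p - 1 := by push_cast; ring
  rw [e1, e2]
  refine h1.trans (mul_le_mul_of_nonneg_right ?_ (sq_nonneg _))
  exact Real.rpow_le_rpow (Nat.cast_nonneg _) (Nat.cast_le.2 hT) (by linarith)

end Blocks

section SparseRecovery

variable {F : Type*} [NormedAddCommGroup F] [InnerProductSpace ℝ F] {N : ℕ}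

/-- `B` has lower and upper restricted isometry constants `α`, `β` on `k`-sparse vectors. -/
structure HasRestrictedIsometry (B : EuclideanSpace ℝ (Fin N) →ₗ[ℝ] F) (k : ℕ) (α β : ℝ) :
    Prop where
  lower : ∀ (T : Finset (Fin N)) (d : EuclideanSpace ℝ (Fin N)), T.card ≤ k →
    (∀ i ∉ T, d i = 0) → α * ‖d‖ ≤ ‖B d‖
  upper : ∀ (T : Finset (Fin N)) (d : EuclideanSpace ℝ (Fin N)), T.card ≤ k →
    (∀ i ∉ T, d i = 0) → ‖B d‖ ≤ β * ‖d‖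

lemma restrictCoord_apply_of_notMem {T : Finset (Fin N)} {v : Fin N → ℝ} {i : Fin N} (h : i ∉ T) :
    restrictCoord T v i = 0 := by
  simp [restrictCoord, h]

lemma HasRestrictedIsometry.inner_map_le {B : EuclideanSpace ℝ (Fin N) →ₗ[ℝ] F} {k : ℕ}
    {α β : ℝ} (hB : HasRestrictedIsometry B k α β) (hα : 0 ≤ α) {T T' : Finset (Fin N)}
    (hTT' : Disjoint T T') (hcard : T.card + T'.card ≤ k) (v : Fin N → ℝ) :
    inner ℝ (B (-restrictCoord T v)) (B (restrictCoord T' v)) ≤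
      (β ^ 2 - α ^ 2) / 2 * (‖restrictCoord T v‖ * ‖restrictCoord T' v‖) := by
  have hsupp : ∀ (a b : ℝ), ∀ i ∉ T ∪ T',
      (a • -restrictCoord T v + b • restrictCoord T' v) i = 0 := by
    intro a b i hi
    rw [Finset.notMem_union] at hi
    simp [restrictCoord_apply_of_notMem hi.1, restrictCoord_apply_of_notMem hi.2]
  have hc : (T ∪ T').card ≤ k := (Finset.card_union_le _ _).trans hcard
  rw [← norm_neg (restrictCoord T v)]
  refine inner_map_le_of_orthogonal B hα ?_ (fun a b => hB.lower _ _ hc (hsupp a b))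
    (fun a b => hB.upper _ _ hc (hsupp a b))
  rw [inner_neg_left, inner_restrictCoord hTT', neg_zero]

lemma card_filter_val_lt_le (s : ℕ) : ({i | i.val < s} : Finset (Fin N)).card ≤ s := by
  rw [← Finset.card_map Fin.valEmbedding]
  refine (Finset.card_le_card (t := Finset.range s) fun x hx => ?_).trans (by simp)
  obtain ⟨i, hi, rfl⟩ := Finset.mem_map.1 hx
  simpa using hi

lemma disjoint_filter_coordBlock (s t k : ℕ) :
    Disjoint ({i | i.val < s} : Finset (Fin N)) (coordBlock N s t k) := by
  rw [Finset.disjoint_left]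
  intro i hi hj
  simp only [coordBlock, Finset.mem_filter, Finset.mem_univ, true_and] at hi hj
  omega

lemma restrictCoord_blocks (s t : ℕ) (v : Fin N → ℝ) :
    WithLp.toLp 2 v = restrictCoord {i | i.val < s} v + restrictCoord (coordBlock N s t 0) v +
      ∑ k ∈ Finset.range N, restrictCoord (coordBlock N s t (k + 1)) v := by
  have h := Finset.sum_range_succ' (fun k => restrictCoord (coordBlock N s t k) v) N
  rw [add_assoc, add_comm (restrictCoord (coordBlock N s t 0) v), ← h]
  ext j
  have h2 := sum_coordBlock s t fun i => if j = i then v i else 0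
  simp only [Finset.sum_ite_eq, Finset.mem_filter, Finset.mem_univ, true_and] at h2
  rw [PiLp.add_apply, WithLp.ofLp_sum, Finset.sum_apply]
  simp only [restrictCoord, Finset.mem_filter, Finset.mem_univ, true_and]
  rw [h2]
  by_cases hj : j.val < s
  · simp [hj, not_le.2 hj]
  · simp [hj, not_lt.1 hj]

/-- Robust null space estimates for a nonincreasing vector under restricted isometry. -/
lemma HasRestrictedIsometry.nullSpace_estimates {B : EuclideanSpace ℝ (Fin N) →ₗ[ℝ] F}
    {s t : ℕ} {α β : ℝ} (hB : HasRestrictedIsometry B (2 * t) α β) (hα : 0 < α) (hαβ : α ≤ β)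
    (hs : 0 < s) (hst : s ≤ t) {p : ℝ} (hp0 : 0 < p) (hp1 : p ≤ 1) {v : Fin N → ℝ}
    (hv0 : ∀ i, 0 ≤ v i) (hv : Antitone v) {θ : ℝ} (hθ : 0 ≤ θ)
    (hBv : ‖B (WithLp.toLp 2 v)‖ ≤ 2 * β * θ) :
    (∑ i with i.val < s, v i ^ p) ^ (1 / p) ≤
      (1 + √2) * (β ^ 2 / α ^ 2) * θ * (s : ℝ) ^ (1 / p - 1 / 2) +
        1 / 4 * (1 + √2) * (β ^ 2 / α ^ 2 - 1) * ((s : ℝ) / t) ^ (1 / p - 1 / 2) *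
          (∑ i with s ≤ i.val, v i ^ p) ^ (1 / p) ∧
    ‖(WithLp.toLp 2 v : EuclideanSpace ℝ (Fin N))‖ ≤ 2 * ((1 + √2) * (β ^ 2 / α ^ 2)) * θ +
      ((1 + √2) * (β ^ 2 / α ^ 2) + 1 - √2) / 2 *
        ((∑ i with s ≤ i.val, v i ^ p) ^ (1 / p) / (t : ℝ) ^ (1 / p - 1 / 2)) := by
  have ht : 0 < t := hs.trans_le hst
  have hs' : (0 : ℝ) < s := Nat.cast_pos.2 hs
  have ht' : (0 : ℝ) < t := Nat.cast_pos.2 ht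
  have hγ : 0 ≤ β ^ 2 / α ^ 2 - 1 := by
    rw [sub_nonneg, one_le_div (by positivity)]
    exact pow_le_pow_left₀ hα.le hαβ 2
  have hr : 1 ≤ 1 / p := by rw [le_div_iff₀ hp0]; linarith
  set R := (∑ i with s ≤ i.val, v i ^ p) ^ (1 / p) with hR
  set T₀ : Finset (Fin N) := {i | i.val < s} with hT₀
  set τ := ∑ k ∈ Finset.range N, ‖restrictCoord (coordBlock N s t (k + 1)) v‖ with hτ
  have hcard₀ : T₀.card ≤ s := card_filter_val_lt_le s
  have hcard : ∀ k, (coordBlock N s t k).card ≤ t := fun k => card_coordBlock_le s k ht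
  have hblocks : ∀ k, 0 ≤ ∑ i ∈ coordBlock N s t k, v i ^ p := fun k =>
    Finset.sum_nonneg fun i _ => Real.rpow_nonneg (hv0 i) p
  have htail : τ ≤ R / (t : ℝ) ^ (1 / p - 1 / 2) := by
    refine (Finset.sum_le_sum fun k _ =>
      norm_restrictCoord_coordBlock_succ_le hp0 hv0 hv ht k).trans ?_
    rw [← Finset.sum_div]
    refine div_le_div_of_nonneg_right ?_ (by positivity)
    refine (sum_rpow_le_rpow_sum _ (fun k _ => hblocks k) hr).trans ?_
    refine Real.rpow_le_rpow (Finset.sum_nonneg fun k _ => hblocks k) ?_ (by positivity)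
    rw [← sum_coordBlock s t]
    exact Finset.sum_le_sum_of_subset_of_nonneg (Finset.range_mono (Nat.le_succ N))
      fun k _ _ => hblocks k
  have hlead := norm_leading_blocks_le B hα hαβ (Finset.range N)
    (fun k => restrictCoord (coordBlock N s t (k + 1)) v) (restrictCoord_blocks s t v)
    (inner_restrictCoord (disjoint_filter_coordBlock s t 0) v)
    (hB.lower (T₀ ∪ coordBlock N s t 0) _
      ((Finset.card_union_le _ _).trans (by have := hcard 0; omega)) (by
        intro i hi
        rw [Finset.notMem_union] at hi
        simp [← hT₀, restrictCoord_apply_of_notMem hi.1, restrictCoord_apply_of_notMem hi.2]))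
    (hB.upper T₀ _ (by omega) fun i hi => restrictCoord_apply_of_notMem hi)
    (hB.upper (coordBlock N s t 0) _ (by have := hcard 0; omega)
      fun i hi => restrictCoord_apply_of_notMem hi)
    (fun k _ => hB.inner_map_le hα.le (disjoint_filter_coordBlock s t (k + 1)).symm
      ((add_le_add (hcard (k + 1)) hcard₀).trans (by omega)) v)
    (fun k _ => hB.inner_map_le hα.le (disjoint_coordBlock s t (Nat.succ_ne_zero k))
      ((add_le_add (hcard (k + 1)) (hcard 0)).trans (by omega)) v) hθ hBv
  rw [← hτ] at hlead
  have hsqrt : 0 ≤ √2 := Real.sqrt_nonneg 2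
  have hmono : (1 + √2) / 2 * (2 * (β ^ 2 / α ^ 2) * θ + (β ^ 2 / α ^ 2 - 1) / 2 * τ) ≤
      (1 + √2) / 2 * (2 * (β ^ 2 / α ^ 2) * θ +
        (β ^ 2 / α ^ 2 - 1) / 2 * (R / (t : ℝ) ^ (1 / p - 1 / 2))) := by
    gcongr
  constructor
  · refine (rpow_sum_rpow_le hp0 hp1 hv0 hs hcard₀).trans ?_
    refine (mul_le_mul_of_nonneg_left (hlead.1.trans hmono) (by positivity)).trans_eq ?_
    rw [Real.div_rpow hs'.le ht'.le]
    ring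
  · rw [restrictCoord_blocks s t v]
    refine ((norm_add_le _ _).trans (add_le_add (norm_add_le _ _) (norm_sum_le _ _))).trans ?_
    rw [← hτ]
    refine (add_le_add (add_le_add (hlead.1.trans hmono) (hlead.2.trans hmono)) htail).trans_eq ?_
    ring

end SparseRecovery

section SchattenStability

variable {N : ℕ}

lemma IsSVD.schattenNorm_eq {X U W : Matrix (Fin N) (Fin N) ℝ} {σ : Fin N → ℝ}
    (h : IsSVD X U W σ) (p : ℝ) : schattenNorm p X = (∑ i, σ i ^ p) ^ (1 / p) := by
  rw [schattenNorm, h.sum_singVals (· ^ p)]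

lemma schattenNorm_two_mul_diagonal_mul {U W : Matrix (Fin N) (Fin N) ℝ}
    (hU : U.transpose * U = 1) (hW : W.transpose * W = 1) (d : EuclideanSpace ℝ (Fin N)) :
    schattenNorm 2 (U * Matrix.diagonal d * W.transpose) = ‖d‖ := by
  rw [schattenNorm, sum_singVals_eq hU hW d (· ^ (2 : ℝ)), EuclideanSpace.norm_eq,
    Real.sqrt_eq_rpow]
  simp

lemma rank_mul_diagonal_mul_le (U W : Matrix (Fin N) (Fin N) ℝ) {d : Fin N → ℝ}
    {T : Finset (Fin N)} (hd : ∀ i ∉ T, d i = 0) :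
    (U * Matrix.diagonal d * W).rank ≤ T.card := by
  refine (Matrix.rank_mul_le_left _ _).trans ((Matrix.rank_mul_le_right _ _).trans ?_)
  rw [Matrix.rank_diagonal, Fintype.card_subtype]
  refine Finset.card_le_card fun i hi => ?_
  by_contra hiT
  exact (Finset.mem_filter.1 hi).2 (hd i hiT)

/-- The diagonal part of a linear map on matrices, in the bases given by the columns of `U`, `W`. -/
def diagonalMap {F : Type*} [AddCommGroup F] [Module ℝ F]
    (A : Matrix (Fin N) (Fin N) ℝ →ₗ[ℝ] F) (U W : Matrix (Fin N) (Fin N) ℝ) :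
    EuclideanSpace ℝ (Fin N) →ₗ[ℝ] F where
  toFun d := A (U * Matrix.diagonal d * W.transpose)
  map_add' d d' := by
    rw [← map_add, ← add_mul, ← mul_add, Matrix.diagonal_add]
    rfl
  map_smul' c d := by
    rw [RingHom.id_apply, ← map_smul, ← Matrix.smul_mul, ← Matrix.mul_smul, ← Matrix.diagonal_smul]
    rfl

lemma hasRestrictedIsometry_diagonalMap {F : Type*} [NormedAddCommGroup F]
    [InnerProductSpace ℝ F] {A : Matrix (Fin N) (Fin N) ℝ →ₗ[ℝ] F} {k : ℕ} {α β : ℝ}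
    (hα : ∀ Z : Matrix (Fin N) (Fin N) ℝ, Z.rank ≤ k → α * schattenNorm 2 Z ≤ ‖A Z‖)
    (hβ : ∀ Z : Matrix (Fin N) (Fin N) ℝ, Z.rank ≤ k → ‖A Z‖ ≤ β * schattenNorm 2 Z)
    {U W : Matrix (Fin N) (Fin N) ℝ} (hU : U.transpose * U = 1) (hW : W.transpose * W = 1) :
    HasRestrictedIsometry (diagonalMap A U W) k α β where
  lower T d hT hd := by
    rw [← schattenNorm_two_mul_diagonal_mul hU hW d]
    exact hα _ ((rank_mul_diagonal_mul_le _ _ hd).trans hT)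
  upper T d hT hd := by
    rw [← schattenNorm_two_mul_diagonal_mul hU hW d]
    exact hβ _ ((rank_mul_diagonal_mul_le _ _ hd).trans hT)

lemma HasRestrictedIsometry.lower_le_upper {F : Type*} [NormedAddCommGroup F]
    [InnerProductSpace ℝ F] {B : EuclideanSpace ℝ (Fin N) →ₗ[ℝ] F} {k : ℕ} {α β : ℝ}
    (hB : HasRestrictedIsometry B k α β) (hN : 0 < N) (hk : 0 < k) : α ≤ β := by
  have hsupp : ∀ i ∉ ({⟨0, hN⟩} : Finset (Fin N)),
      (EuclideanSpace.single ⟨0, hN⟩ 1 : EuclideanSpace ℝ (Fin N)) i = 0 := by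
    intro i hi
    simpa using fun h => hi (by simp [h])
  have hcard : ({⟨0, hN⟩} : Finset (Fin N)).card ≤ k := by rwa [Finset.card_singleton]
  simpa using (hB.lower _ _ hcard hsupp).trans (hB.upper _ _ hcard hsupp)

/-- The tail of the singular values bounds the error of best low rank approximation from below. -/
lemma IsSVD.tail_le_rhoS {X U W : Matrix (Fin N) (Fin N) ℝ} {σ : Fin N → ℝ}
    (h : IsSVD X U W σ) {p : ℝ} (hp0 : 0 < p) (s : ℕ) :
    (∑ i with s ≤ i.val, σ i ^ p) ^ (1 / p) ≤ rhoS p s X := by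
  refine le_csInf ⟨_, 0, by simp, rfl⟩ ?_
  rintro _ ⟨Y, hY, rfl⟩
  obtain ⟨U', W', τ, hτ⟩ := exists_isSVD (X - Y)
  simp only [hτ.schattenNorm_eq p]
  refine Real.rpow_le_rpow (Finset.sum_nonneg fun i _ => Real.rpow_nonneg (h.nonneg i) p) ?_
    (by positivity)
  let g : Fin N → Fin N := fun i => ⟨i.val - s, by omega⟩
  have hle : ∀ i ∈ ({i | s ≤ i.val} : Finset (Fin N)), σ i ^ p ≤ τ (g i) ^ p := by
    intro i hi
    refine Real.rpow_le_rpow (h.nonneg i) (h.le_of_rank_le (k := s) ?_ hτ ?_) hp0.le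
    · simpa using hY
    · simp only [Finset.mem_filter, Finset.mem_univ, true_and] at hi
      simp only [g]
      omega
  refine (Finset.sum_le_sum hle).trans ?_
  have hinj : Set.InjOn g ({i | s ≤ i.val} : Finset (Fin N)) := by
    intro i hi j hj hij
    simp only [Finset.coe_filter, Finset.mem_univ, true_and, Set.mem_ofPred_eq] at hi hj
    simp only [g, Fin.mk.injEq] at hij
    exact Fin.ext (by omega)
  rw [← Finset.sum_image (f := fun i => τ i ^ p) hinj]
  exact Finset.sum_le_univ_sum_of_nonneg fun i => Real.rpow_nonneg (hτ.nonneg i) p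

lemma sum_tail_le {p : ℝ} {x v : Fin N → ℝ}
    (h : ∑ i, |x i ^ p - v i ^ p| ≤ ∑ i, x i ^ p) (s : ℕ) :
    ∑ i with s ≤ i.val, v i ^ p ≤
      ∑ i with i.val < s, v i ^ p + 2 * ∑ i with s ≤ i.val, x i ^ p := by
  have hsplit : ∀ f : Fin N → ℝ, ∑ i, f i = ∑ i with i.val < s, f i + ∑ i with s ≤ i.val, f i := by
    intro f
    rw [← Finset.sum_filter_add_sum_filter_not _ fun i : Fin N => i.val < s]
    simp only [not_lt]
  rw [hsplit, hsplit fun i => x i ^ p] at h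
  have h1 : ∑ i with i.val < s, x i ^ p - ∑ i with i.val < s, v i ^ p ≤
      ∑ i with i.val < s, |x i ^ p - v i ^ p| := by
    rw [← Finset.sum_sub_distrib]
    exact Finset.sum_le_sum fun i _ => le_abs_self _
  have h2 : ∑ i with s ≤ i.val, v i ^ p - ∑ i with s ≤ i.val, x i ^ p ≤
      ∑ i with s ≤ i.val, |x i ^ p - v i ^ p| := by
    rw [← Finset.sum_sub_distrib]
    exact Finset.sum_le_sum fun i _ => (le_abs_self _).trans_eq (abs_sub_comm _ _)
  linarith

lemma rpow_add_le_mul_rpow_add_rpow {a b r : ℝ} (ha : 0 ≤ a) (hb : 0 ≤ b) (hr : 1 ≤ r) :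
    (a + b) ^ r ≤ 2 ^ (r - 1) * (a ^ r + b ^ r) := by
  lift a to NNReal using ha
  lift b to NNReal using hb
  exact_mod_cast NNReal.rpow_add_le_mul_rpow_add_rpow a b hr

/-- Combining the null space estimate with the cone condition, for head `H` and tail `T`. -/
lemma quasinorm_bounds {p H T Q L μ ρ : ℝ} (hp0 : 0 < p) (hp1 : p ≤ 1) (hH : 0 ≤ H) (hT : 0 ≤ T)
    (hQ : 0 ≤ Q) (hL : 0 ≤ L) (hμ0 : 0 ≤ μ) (hμ1 : μ < 1)
    (hhead : H ^ (1 / p) ≤ L + μ * T ^ (1 / p)) (htail : T ≤ H + 2 * Q)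
    (hρ : Q ^ (1 / p) ≤ ρ) :
    (H + T) ^ (1 / p) ≤ 2 ^ (2 / p - 1) * (1 + μ ^ p) ^ (1 / p) / (1 - μ ^ p) ^ (1 / p) * ρ +
      2 ^ (2 / p - 1) / (1 - μ ^ p) ^ (1 / p) * L ∧
    T ^ (1 / p) ≤ 2 ^ (1 / p - 1) * (2 ^ (1 / p) * ρ + L) / (1 - μ ^ p) ^ (1 / p) := by
  have hr : 1 ≤ 1 / p := by rw [le_div_iff₀ hp0]; linarith
  have hr0 : 0 ≤ 1 / p := by positivity
  have hpow : ∀ {x : ℝ}, 0 ≤ x → (x ^ (1 / p)) ^ p = x := fun hx => by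
    rw [← Real.rpow_mul hx, one_div_mul_cancel hp0.ne', Real.rpow_one]
  have hpow' : ∀ {x : ℝ}, 0 ≤ x → (x ^ p) ^ (1 / p) = x := fun hx => by
    rw [← Real.rpow_mul hx, mul_one_div_cancel hp0.ne', Real.rpow_one]
  have hM0 : 0 ≤ μ ^ p := Real.rpow_nonneg hμ0 p
  have hM1 : 0 < 1 - μ ^ p := sub_pos.2 (Real.rpow_lt_one hμ0 hμ1 hp0)
  have hLp : 0 ≤ L ^ p := Real.rpow_nonneg hL p
  have hTr : 0 ≤ T ^ (1 / p) := Real.rpow_nonneg hT _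
  have hHle : H ≤ L ^ p + μ ^ p * T := by
    have h1 := Real.rpow_le_rpow (Real.rpow_nonneg hH _) hhead hp0.le
    rw [hpow hH] at h1
    refine h1.trans ((Real.rpow_add_le_add_rpow hL (by positivity) hp0.le hp1).trans_eq ?_)
    rw [Real.mul_rpow hμ0 hTr, hpow hT]
  have hTle : T ≤ (2 * Q + L ^ p) / (1 - μ ^ p) := by
    rw [le_div_iff₀ hM1]
    linarith
  have hHT : H + T ≤ (2 * (1 + μ ^ p) * Q + 2 * L ^ p) / (1 - μ ^ p) := by
    have h1 := (le_div_iff₀ hM1).1 hTle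
    rw [le_div_iff₀ hM1]
    nlinarith [mul_le_mul_of_nonneg_left h1 (by positivity : 0 ≤ 1 + μ ^ p),
      mul_le_mul_of_nonneg_right hHle hM1.le]
  have hD : 0 < (1 - μ ^ p) ^ (1 / p) := Real.rpow_pos_of_pos hM1 _
  have h2 : (2 : ℝ) ^ (2 / p - 1) = 2 ^ (1 / p - 1) * 2 ^ (1 / p) := by
    rw [← Real.rpow_add two_pos]
    congr 1
    ring
  constructor
  · refine (Real.rpow_le_rpow (by positivity) hHT hr0).trans ?_
    rw [Real.div_rpow (by positivity) hM1.le]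
    have h3 := rpow_add_le_mul_rpow_add_rpow (a := 2 * (1 + μ ^ p) * Q) (b := 2 * L ^ p)
      (by positivity) (by positivity) hr
    rw [Real.mul_rpow (by positivity) hQ, Real.mul_rpow zero_le_two (by positivity),
      Real.mul_rpow zero_le_two hLp, hpow' hL] at h3
    refine (div_le_div_of_nonneg_right (h3.trans (mul_le_mul_of_nonneg_left (add_le_add_left
      (mul_le_mul_of_nonneg_left hρ (by positivity)) _) (by positivity))) hD.le).trans_eq ?_
    rw [h2]
    ring
  · refine (Real.rpow_le_rpow hT hTle hr0).trans ?_
    rw [Real.div_rpow (by positivity) hM1.le]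
    refine div_le_div_of_nonneg_right ?_ hD.le
    refine (rpow_add_le_mul_rpow_add_rpow (by positivity) hLp hr).trans ?_
    rw [Real.mul_rpow zero_le_two hQ, hpow' hL]
    gcongr

end SchattenStability

/-- Stability and robustness of low-rank matrix recovery via Schatten `p`-quasi-norm
minimization (matrix version of the Foucart–Lai theorem). -/
theorem stability_schatten_p_minimization
    (p : ℝ) (hp0 : 0 < p) (hp1 : p ≤ 1)
    (N m s t : ℕ) (hN : 0 < N) (hm : 0 < m) (hs : 0 < s) (hst : s ≤ t)
    (A : Matrix (Fin N) (Fin N) ℝ →ₗ[ℝ] EuclideanSpace ℝ (Fin m))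
    (α β βs : ℝ) (hαpos : 0 < α)
    -- `α` is the best lower constant for matrices of rank at most `2t`
    (hα : ∀ Z : Matrix (Fin N) (Fin N) ℝ, Z.rank ≤ 2 * t →
      α * schattenNorm 2 Z ≤ ‖A Z‖)
    (hαbest : ∀ a : ℝ, (∀ Z : Matrix (Fin N) (Fin N) ℝ, Z.rank ≤ 2 * t →
      a * schattenNorm 2 Z ≤ ‖A Z‖) → a ≤ α)
    -- `β` is the best upper constant for matrices of rank at most `2t`
    (hβ : ∀ Z : Matrix (Fin N) (Fin N) ℝ, Z.rank ≤ 2 * t →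
      ‖A Z‖ ≤ β * schattenNorm 2 Z)
    (hβbest : ∀ b : ℝ, (∀ Z : Matrix (Fin N) (Fin N) ℝ, Z.rank ≤ 2 * t →
      ‖A Z‖ ≤ b * schattenNorm 2 Z) → β ≤ b)
    -- `βs` is the best upper constant for matrices of rank at most `2s`
    (hβs : ∀ Z : Matrix (Fin N) (Fin N) ℝ, Z.rank ≤ 2 * s →
      ‖A Z‖ ≤ βs * schattenNorm 2 Z)
    (hβsbest : ∀ b : ℝ, (∀ Z : Matrix (Fin N) (Fin N) ℝ, Z.rank ≤ 2 * s →
      ‖A Z‖ ≤ b * schattenNorm 2 Z) → βs ≤ b)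
    (γ lam mu : ℝ)
    (hγ : γ = β ^ 2 / α ^ 2)
    (hγcond : γ - 1 < 4 * (Real.sqrt 2 - 1) * ((t : ℝ) / s) ^ (1 / p - 1 / 2))
    (hlam : lam = (1 + Real.sqrt 2) * γ)
    (hmu : mu = (1 / 4) * (1 + Real.sqrt 2) * (γ - 1) * ((s : ℝ) / t) ^ (1 / p - 1 / 2))
    (θ : ℝ) (hθ : 0 ≤ θ) (y : EuclideanSpace ℝ (Fin m))
    (X : Matrix (Fin N) (Fin N) ℝ) (hX : ‖A X - y‖ ≤ βs * θ)
    (Xstar : Matrix (Fin N) (Fin N) ℝ)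
    (hfeas : ‖A Xstar - y‖ ≤ βs * θ)
    (hmin : ∀ Z : Matrix (Fin N) (Fin N) ℝ, ‖A Z - y‖ ≤ βs * θ →
      schattenNorm p Xstar ≤ schattenNorm p Z) :
    mu < 1 ∧
    schattenNorm p (X - Xstar) ≤
      (2 : ℝ) ^ (2 / p - 1) * (1 + mu ^ p) ^ (1 / p) / (1 - mu ^ p) ^ (1 / p) * rhoS p s X
        + (2 : ℝ) ^ (2 / p - 1) * lam / (1 - mu ^ p) ^ (1 / p)
            * (s : ℝ) ^ (1 / p - 1 / 2) * θ ∧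
    schattenNorm 2 (X - Xstar) ≤
      (2 : ℝ) ^ (2 / p - 2) * (lam + 1 - Real.sqrt 2) / (1 - mu ^ p) ^ (1 / p)
          * (rhoS p s X / (t : ℝ) ^ (1 / p - 1 / 2))
        + ((2 : ℝ) ^ (1 / p - 2) * lam * (lam + 1 - Real.sqrt 2) / (1 - mu ^ p) ^ (1 / p)
            + 2 * lam) * θ := by
  have ht : 0 < t := hs.trans_le hst
  have hs' : (0 : ℝ) < s := Nat.cast_pos.2 hs
  have ht' : (0 : ℝ) < t := Nat.cast_pos.2 ht
  have hr : 1 ≤ 1 / p := by rw [le_div_iff₀ hp0]; linarith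
  obtain ⟨U, W, v, hV⟩ := exists_isSVD (X - Xstar)
  obtain ⟨U₁, W₁, x, hXsvd⟩ := exists_isSVD X
  obtain ⟨U₂, W₂, z, hZsvd⟩ := exists_isSVD Xstar
  have hB := hasRestrictedIsometry_diagonalMap hα hβ hV.left_orth hV.right_orth
  have hαβ : α ≤ β := hB.lower_le_upper hN (by omega)
  have hγ1 : 1 ≤ γ := by
    rw [hγ, one_le_div (by positivity)]
    exact pow_le_pow_left₀ hαpos.le hαβ 2
  have hsqrt : √2 * √2 = 2 := Real.mul_self_sqrt zero_le_two
  have hsqrt0 : 0 ≤ √2 := Real.sqrt_nonneg 2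
  have hmu0 : 0 ≤ mu := by
    rw [hmu]
    have := sub_nonneg.2 hγ1
    positivity
  have hmu1 : mu < 1 := by
    have hq : 0 < ((s : ℝ) / t) ^ (1 / p - 1 / 2) := by positivity
    have hinv : ((t : ℝ) / s) ^ (1 / p - 1 / 2) * ((s : ℝ) / t) ^ (1 / p - 1 / 2) = 1 := by
      rw [← Real.mul_rpow (by positivity) (by positivity), div_mul_div_cancel₀ hs'.ne',
        div_self ht'.ne', Real.one_rpow]
    calc mu = 1 / 4 * (1 + √2) * ((s : ℝ) / t) ^ (1 / p - 1 / 2) * (γ - 1) := by rw [hmu]; ring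
      _ < 1 / 4 * (1 + √2) * ((s : ℝ) / t) ^ (1 / p - 1 / 2) *
          (4 * (√2 - 1) * ((t : ℝ) / s) ^ (1 / p - 1 / 2)) :=
        mul_lt_mul_of_pos_left hγcond (by positivity)
      _ = (√2 * √2 - 1) *
          (((t : ℝ) / s) ^ (1 / p - 1 / 2) * ((s : ℝ) / t) ^ (1 / p - 1 / 2)) := by ring
      _ = 1 := by rw [hinv, hsqrt]; norm_num
  have hβsβ : βs ≤ β := hβsbest β fun Z hZ => hβ Z (hZ.trans (by omega))
  have hBv : ‖diagonalMap A U W (WithLp.toLp 2 v)‖ ≤ 2 * β * θ := by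
    have heq : diagonalMap A U W (WithLp.toLp 2 v) = (A X - y) - (A Xstar - y) := by
      rw [sub_sub_sub_cancel_right, ← map_sub, hV.eq]
      rfl
    rw [heq]
    refine (norm_sub_le _ _).trans ((add_le_add hX hfeas).trans ?_)
    nlinarith [mul_le_mul_of_nonneg_right hβsβ hθ]
  obtain ⟨hhead, hnorm⟩ := hB.nullSpace_estimates hαpos hαβ hs hst hp0 hp1 hV.nonneg hV.anti hθ hBv
  rw [← hγ, ← hlam, ← hmu] at hhead
  rw [← hγ, ← hlam] at hnorm
  have hnonneg : ∀ {f : Fin N → ℝ}, (∀ i, 0 ≤ f i) → ∀ T : Finset (Fin N),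
      0 ≤ ∑ i ∈ T, f i ^ p := fun hf T => Finset.sum_nonneg fun i _ => Real.rpow_nonneg (hf i) p
  have hcone : ∑ i, |x i ^ p - v i ^ p| ≤ ∑ i, x i ^ p := by
    refine (hXsvd.sum_abs_rpow_sub_le hp0 hp1 hV hZsvd (by abel)).trans ?_
    have h := hmin X hX
    rw [hXsvd.schattenNorm_eq, hZsvd.schattenNorm_eq] at h
    exact (Real.rpow_le_rpow_iff (hnonneg hZsvd.nonneg _) (hnonneg hXsvd.nonneg _)
      (by positivity)).1 h
  have hlam0 : 0 ≤ lam := by rw [hlam]; positivity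
  obtain ⟨hp, htail⟩ := quasinorm_bounds hp0 hp1 (hnonneg hV.nonneg _) (hnonneg hV.nonneg _)
    (hnonneg hXsvd.nonneg _) (by positivity) hmu0 hmu1 hhead (sum_tail_le hcone s)
    (hXsvd.tail_le_rhoS hp0 s)
  have hD : 0 < (1 - mu ^ p) ^ (1 / p) :=
    Real.rpow_pos_of_pos (sub_pos.2 (Real.rpow_lt_one hmu0 hmu1 hp0)) _
  refine ⟨hmu1, ?_, ?_⟩
  · rw [hV.schattenNorm_eq,
      ← Finset.sum_filter_add_sum_filter_not _ fun i : Fin N => i.val < s]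
    simp only [not_lt]
    refine hp.trans_eq ?_
    ring
  · have hVnorm : schattenNorm 2 (X - Xstar) = ‖(WithLp.toLp 2 v : EuclideanSpace ℝ (Fin N))‖ := by
      rw [hV.eq]
      exact schattenNorm_two_mul_diagonal_mul hV.left_orth hV.right_orth (WithLp.toLp 2 v)
    have hc : 0 ≤ lam + 1 - √2 := by
      rw [hlam]
      nlinarith
    have hte : 0 < (t : ℝ) ^ (1 / p - 1 / 2) := by positivity
    have hst' : (s : ℝ) ^ (1 / p - 1 / 2) / (t : ℝ) ^ (1 / p - 1 / 2) ≤ 1 :=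
      (div_le_one hte).2 (Real.rpow_le_rpow hs'.le (Nat.cast_le.2 hst) (by linarith))
    have h2 : (2 : ℝ) ^ (2 / p - 2) = 2 ^ (1 / p - 1) * 2 ^ (1 / p) / 2 := by
      rw [← Real.rpow_add two_pos, ← Real.rpow_sub_one two_ne_zero]
      congr 1
      ring
    have h2' : (2 : ℝ) ^ (1 / p - 2) = 2 ^ (1 / p - 1) / 2 := by
      rw [← Real.rpow_sub_one two_ne_zero]
      congr 1
      ring
    rw [hVnorm]
    refine hnorm.trans ((add_le_add_right (mul_le_mul_of_nonneg_left
      (div_le_div_of_nonneg_right htail hte.le) (div_nonneg hc zero_le_two)) _).trans ?_)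
    have h3 := mul_le_mul_of_nonneg_left hst' (by positivity : 0 ≤
      2 ^ (1 / p - 2) * lam * (lam + 1 - √2) / (1 - mu ^ p) ^ (1 / p) * θ)
    rw [h2'] at h3
    rw [h2, h2']
    linear_combination h3
end
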